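/- arXiv:1804.00439 — 3 statements merged into one kernel-verified Lean document; each statement's English description precedes it below -/
import Mathlib

section
/- Let F : [0,T]×ℝ×ℝ → ℝ be a Carathéodory function. For ū ∈ ℝ and λ ∈ [0,1], consider the problem (★)_{ū,λ}: find ũ ∈ 𝔇 with ∫₀ᵀ ũ(t) dt = 0 such that (φ(ũ'))'(t) = λ·( F(t, ū + ũ(t), ũ'(t)) − (1/T)∫₀ᵀ F(ξ, ū + ũ(ξ), ũ'(ξ)) dξ ) for a.e. t ∈ [0,T]. Suppose there exists ū₀ ∈ ℝ such that the set of all solutions ũ of (★)_{ū₀,λ}, over all λ ∈ [0,1], is bounded in the C¹ norm. Suppose moreover that for every M > 0 there exists M' > 0 such that every solution pair (ū, ũ) of (★)_{ū,1} with |ū| ≤ M satisfies ‖ũ‖_∞ + ‖ũ'‖_∞ ≤ M'. Then there exists a closed and connected set 𝒞 ⊆ ℝ × C¹_T of solution pairs (ū, ũ) of (★)_{ū,1} such that the projection of 𝒞 onto ℝ, {ū ∈ ℝ : (ū,ũ) ∈ 𝒞 for some ũ}, is all of ℝ. -/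
open MeasureTheory Set Filter

noncomputable section

/-- The Lebesgue measure restricted to the interval `[0,T]`. -/
def muT (T : ℝ) : Measure ℝ := volume.restrict (Icc 0 T)

/-- `u` is a `C¹` function on `[0,T]` with derivative `u'` there, satisfying the
`T`-periodic boundary conditions `u 0 = u T` and `u' 0 = u' T`. -/
def IsC1Periodic (T : ℝ) (u u' : ℝ → ℝ) : Prop :=
  (∀ t ∈ Icc (0:ℝ) T, HasDerivWithinAt u (u' t) (Icc (0:ℝ) T) t) ∧
    ContinuousOn u' (Icc (0:ℝ) T) ∧ u 0 = u T ∧ u' 0 = u' T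

/-- `φ ∘ u'` is absolutely continuous on `[0,T]`, being the indefinite integral of the
integrable function `w` (which is then its a.e. derivative). -/
def IsACPhiDeriv (T : ℝ) (φ : ℝ → ℝ) (u' w : ℝ → ℝ) : Prop :=
  IntegrableOn w (Icc (0:ℝ) T) ∧
    ∀ t ∈ Icc (0:ℝ) T, φ (u' t) = φ (u' 0) + ∫ τ in (0:ℝ)..t, w τ

/-- `F : [0,T] × ℝ × ℝ → ℝ` is a Carathéodory function. -/
def CaratheodoryF (T : ℝ) (F : ℝ → ℝ → ℝ → ℝ) : Prop :=
  (∀ x y : ℝ, Measurable fun t => F t x y) ∧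
    (∀ᵐ t ∂(muT T), Continuous fun p : ℝ × ℝ => F t p.1 p.2) ∧
    ∀ r : ℝ, 0 < r → ∃ γ : ℝ → ℝ, IntegrableOn γ (Icc (0:ℝ) T) ∧
      ∀ᵐ t ∂(muT T), ∀ x y : ℝ, |x| ≤ r → |y| ≤ r → |F t x y| ≤ γ t

/-- `(ũ, ũ')` solves the problem `(★)_{ū,λ}`: `ũ ∈ 𝔇` has zero mean and
`(φ(ũ'))' = λ (F(t, ū+ũ, ũ') − (1/T)∫₀ᵀ F(ξ, ū+ũ(ξ), ũ'(ξ)) dξ)` a.e. on `[0,T]`. -/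
def StarSol (T : ℝ) (φ : ℝ → ℝ) (F : ℝ → ℝ → ℝ → ℝ) (ub lam : ℝ)
    (ut ut' : ℝ → ℝ) : Prop :=
  IsC1Periodic T ut ut' ∧ (∫ t in Icc (0:ℝ) T, ut t) = 0 ∧
    ∃ w : ℝ → ℝ, IntegrableOn w (Icc (0:ℝ) T) ∧
      (∀ t ∈ Icc (0:ℝ) T, φ (ut' t) = φ (ut' 0) + ∫ τ in (0:ℝ)..t, w τ) ∧
      ∀ᵐ t ∂(muT T), w t = lam * (F t (ub + ut t) (ut' t) -
        (1 / T) * ∫ ξ in Icc (0:ℝ) T, F ξ (ub + ut ξ) (ut' ξ))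


section Brouwer

open Topology NNReal

theorem exists_weights_det_one_add_eq_sum (n : ℕ) {δ : ℝ} (hδ : 0 < δ) :
    ∃ (v c : Fin (n + 1) → ℝ), (∀ i, 0 < v i ∧ v i < δ) ∧ ∑ i, c i = 1 ∧
      ∀ A : Matrix (Fin n) (Fin n) ℝ, (1 + A).det = ∑ i, c i * (1 + v i • A).det := by
  classical
  let v : Fin (n + 1) → ℝ := fun i => δ * ((i : ℝ) + 1) / (n + 2)
  have hv : Function.Injective v := by
    intro i j h
    have h2 : (0 : ℝ) < n + 2 := by positivity
    simp only [v] at h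
    rw [div_left_inj' h2.ne', mul_right_inj' hδ.ne'] at h
    ext
    exact_mod_cast add_right_cancel h
  have key : ∀ p : Polynomial ℝ, p.natDegree ≤ n →
      p.eval 1 = ∑ i, ((Lagrange.basis Finset.univ v i).eval 1) * p.eval (v i) := by
    intro p hp
    have hdeg : p.degree < (Finset.univ : Finset (Fin (n + 1))).card := by
      rw [Finset.card_univ, Fintype.card_fin]
      exact lt_of_le_of_lt Polynomial.degree_le_natDegree (by exact_mod_cast Nat.lt_succ_of_le hp)
    conv_lhs => rw [Lagrange.eq_interpolate hv.injOn hdeg, Lagrange.interpolate_apply]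
    rw [Polynomial.eval_finsetSum]
    refine Finset.sum_congr rfl fun i _ => ?_
    rw [Polynomial.eval_mul, Polynomial.eval_C, mul_comm]
  refine ⟨v, fun i => (Lagrange.basis Finset.univ v i).eval 1, fun i => ⟨by positivity, ?_⟩, ?_, ?_⟩
  · have h2 : (0 : ℝ) < n + 2 := by positivity
    have hi : (i : ℝ) + 1 < n + 2 := by
      have : (i : ℕ) < n + 1 := i.2
      have : ((i : ℕ) : ℝ) < ((n + 1 : ℕ) : ℝ) := by exact_mod_cast this
      push_cast at this
      linarith
    simp only [v]
    rw [div_lt_iff₀ h2]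
    exact mul_lt_mul_of_pos_left hi hδ
  · simpa using (key 1 (by simp)).symm
  · intro A
    have hp := Polynomial.natDegree_det_X_add_C_le A (1 : Matrix (Fin n) (Fin n) ℝ)
    rw [Fintype.card_fin] at hp
    have hev : ∀ t : ℝ, Polynomial.eval t (Matrix.det
        ((Polynomial.X : Polynomial ℝ) • A.map Polynomial.C +
          (1 : Matrix (Fin n) (Fin n) ℝ).map Polynomial.C)) = (1 + t • A).det := by
      intro t
      rw [← Polynomial.coe_evalRingHom, RingHom.map_det]
      congr 1
      ext i j
      by_cases hij : i = j <;> simp [hij, add_comm] <;> ring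
    have := key _ hp
    simp only [hev, one_smul] at this
    exact this

variable {E : Type*} [NormedAddCommGroup E] [InnerProductSpace ℝ E] [FiniteDimensional ℝ E]

theorem exists_weights_continuousLinearMap_det_one_add_eq_sum {δ : ℝ} (hδ : 0 < δ) :
    ∃ (m : ℕ) (v c : Fin m → ℝ), (∀ i, 0 < v i ∧ v i < δ) ∧ ∑ i, c i = 1 ∧
      ∀ A : E →L[ℝ] E, (1 + A).det = ∑ i, c i * (1 + v i • A).det := by
  obtain ⟨v, c, hv, hc, h⟩ := exists_weights_det_one_add_eq_sum (Module.finrank ℝ E) hδ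
  refine ⟨_, v, c, hv, hc, fun A => ?_⟩
  let b := Module.finBasis ℝ E
  have hdet : ∀ t : ℝ, (1 + t • A).det = (1 + t • LinearMap.toMatrix b b (A : E →ₗ[ℝ] E)).det := by
    intro t
    rw [ContinuousLinearMap.det, ← LinearMap.det_toMatrix b]
    congr 1
    have : ((1 + t • A : E →L[ℝ] E) : E →ₗ[ℝ] E) = LinearMap.id + t • (A : E →ₗ[ℝ] E) := rfl
    rw [this, map_add, map_smul, LinearMap.toMatrix_id]
  have h1 := hdet 1
  rw [one_smul, one_smul] at h1
  rw [h1, h]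
  simp only [hdet]

theorem bijective_id_add_of_lipschitz {g : E → E} {K : ℝ≥0} (hK : K < 1) (hg : LipschitzWith K g) :
    Function.Bijective (fun x => x + g x) := by
  constructor
  · intro x y hxy
    have h1 := hg.dist_le_mul x y
    have h2 : x - y = g y - g x := by
      have : x + g x = y + g y := hxy
      rw [sub_eq_sub_iff_add_eq_add, this, add_comm]
    have h3 : dist x y ≤ K * dist x y := by
      calc dist x y = ‖x - y‖ := dist_eq_norm _ _
        _ = dist (g x) (g y) := by rw [h2, dist_comm, dist_eq_norm]
        _ ≤ _ := h1
    have hK' : (K : ℝ) < 1 := by exact_mod_cast hK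
    have : dist x y ≤ 0 := by nlinarith [dist_nonneg (x := x) (y := y)]
    exact dist_le_zero.1 this
  · intro y
    have hc : ContractingWith K (fun x => y - g x) := by
      refine ⟨hK, LipschitzWith.of_dist_le_mul fun a b => ?_⟩
      rw [dist_sub_left]
      exact hg.dist_le_mul a b
    refine ⟨hc.fixedPoint, ?_⟩
    have : y - g hc.fixedPoint = hc.fixedPoint := hc.fixedPoint_isFixedPt
    exact (eq_add_of_sub_eq this).symm

variable [MeasurableSpace E] [BorelSpace E]

theorem integral_det_one_add_fderiv_eq {g : E → E} {K : ℝ≥0} (hg : LipschitzWith K g)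
    (h0 : ∀ x ∉ Metric.ball (0 : E) 1, g x = 0)
    (hd : ∀ x ∈ Metric.ball (0 : E) 1, DifferentiableAt ℝ g x) :
    ∫ x in Metric.ball (0 : E) 1, (1 + fderiv ℝ g x).det =
      volume.real (Metric.ball (0 : E) 1) := by
  have hcont : ContinuousAt (fun A : E →L[ℝ] E => (1 + A).det) 0 := by
    exact (ContinuousLinearMap.continuous_det.comp
        (continuous_const.add continuous_id)).continuousAt
  have hpos : ∀ᶠ A : E →L[ℝ] E in 𝓝 0, 0 < (1 + A).det := by
    refine hcont.eventually (lt_mem_nhds ?_)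
    show 0 < (1 + (0 : E →L[ℝ] E)).det
    rw [add_zero]
    have : (1 : E →L[ℝ] E).det = 1 := LinearMap.det_id
    rw [this]
    exact one_pos
  obtain ⟨ε, hε, hball⟩ := Metric.eventually_nhds_iff.1 hpos
  have hK1 : (0 : ℝ) < K + 1 := by positivity
  obtain ⟨m, v, c, hv, hc, hsum⟩ := exists_weights_continuousLinearMap_det_one_add_eq_sum (E := E)
    (δ := min ε 1 / (K + 1)) (by positivity)
  have hvK : ∀ i, v i * (K + 1) < min ε 1 := fun i => (lt_div_iff₀ hK1).1 (hv i).2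
  have hmeas : ∀ t : ℝ, Measurable fun x => (1 + t • fderiv ℝ g x).det := fun t => by
    have h2 : Continuous fun A : E →L[ℝ] E => (1 + t • A).det :=
      ContinuousLinearMap.continuous_det.comp
        (continuous_const.add (continuous_id.const_smul t))
    exact h2.measurable.comp (measurable_fderiv ℝ g)
  have hdetpos : ∀ i x, 0 < (1 + v i • fderiv ℝ g x).det := fun i x => by
    apply hball
    rw [dist_zero_right, norm_smul, Real.norm_of_nonneg (hv i).1.le]
    have h1 : ‖fderiv ℝ g x‖ ≤ K := norm_fderiv_le_of_lipschitz ℝ hg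
    have h2 := hvK i
    have h3 := (hv i).1
    have h4 := min_le_left ε 1
    nlinarith
  have hvol : ∀ i, ∫⁻ x in Metric.ball (0 : E) 1, ENNReal.ofReal ((1 + v i • fderiv ℝ g x).det) =
      volume (Metric.ball (0 : E) 1) := fun i => by
    have hlip : LipschitzWith ((v i).toNNReal * K) (fun x => v i • g x) := by
      refine LipschitzWith.of_dist_le_mul fun a b => ?_
      rw [dist_smul₀, Real.norm_of_nonneg (hv i).1.le, NNReal.coe_mul,
        Real.coe_toNNReal _ (hv i).1.le, mul_assoc]
      exact mul_le_mul_of_nonneg_left (hg.dist_le_mul a b) (hv i).1.le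
    have hbij := bijective_id_add_of_lipschitz (by
      rw [← NNReal.coe_lt_coe, NNReal.coe_mul, Real.coe_toNNReal _ (hv i).1.le, NNReal.coe_one]
      have h2 := hvK i
      have h3 := (hv i).1
      have h4 := min_le_right ε 1
      nlinarith) hlip
    have himg : (fun x => x + v i • g x) '' Metric.ball (0 : E) 1 = Metric.ball (0 : E) 1 := by
      have hcompl : (fun x => x + v i • g x) '' (Metric.ball (0 : E) 1)ᶜ =
          (Metric.ball (0 : E) 1)ᶜ := by
        conv_rhs => rw [← image_id (Metric.ball (0 : E) 1)ᶜ]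
        exact image_congr fun x hx => by simp [h0 x hx]
      rw [image_compl_eq hbij] at hcompl
      exact compl_injective hcompl
    conv_rhs => rw [← himg]
    rw [← lintegral_abs_det_fderiv_eq_addHaar_image (f' := fun x => 1 + v i • fderiv ℝ g x) volume
      Metric.isOpen_ball.measurableSet _ hbij.injective.injOn]
    · simp only [abs_of_pos (hdetpos i _)]
    · intro x hx
      exact ((hasFDerivAt_id x).add ((hd x hx).hasFDerivAt.const_smul (v i))).hasFDerivWithinAt
  have hfin : volume (Metric.ball (0 : E) 1) < ⊤ := measure_ball_lt_top
  have h_int : ∀ i, IntegrableOn (fun x => (1 + v i • fderiv ℝ g x).det)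
      (Metric.ball (0 : E) 1) := by
    intro i
    refine ⟨(hmeas _).aestronglyMeasurable, ?_⟩
    rw [hasFiniteIntegral_iff_ofReal (Eventually.of_forall fun x => (hdetpos i x).le), hvol i]
    exact hfin
  have heq : ∀ i, ∫ x in Metric.ball (0 : E) 1, (1 + v i • fderiv ℝ g x).det =
      volume.real (Metric.ball (0 : E) 1) := by
    intro i
    rw [integral_eq_lintegral_of_nonneg_ae (Eventually.of_forall fun x => (hdetpos i x).le)
      (hmeas _).aestronglyMeasurable, hvol i]
    rfl
  rw [integral_congr_ae (Eventually.of_forall fun x => hsum (fderiv ℝ g x))]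
  rw [integral_finsetSum _ fun i _ => (h_int i).const_mul _]
  simp only [integral_const_mul, heq]
  rw [← Finset.sum_mul, hc, one_mul]

theorem not_exists_retraction_onto_sphere {r : E → E}
    (hr : ∀ x ∈ Metric.closedBall (0 : E) 1, ContDiffAt ℝ 1 r x)
    (hs : ∀ x ∈ Metric.sphere (0 : E) 1, r x = x)
    (hn : ∀ x ∈ Metric.closedBall (0 : E) 1, ‖r x‖ = 1) : False := by
  classical
  let B := Metric.ball (0 : E) 1
  let g : E → E := fun x => if x ∈ B then r x - x else 0
  have hgB : ∀ x ∈ B, g =ᶠ[𝓝 x] fun y => r y - y := fun x hx => by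
    filter_upwards [Metric.isOpen_ball.mem_nhds hx] with y hy
    exact if_pos hy
  have hgcB : ∀ x ∈ Metric.closedBall (0 : E) 1, g x = r x - x := fun x hx => by
    by_cases hxB : x ∈ B
    · exact if_pos hxB
    · have : x ∈ Metric.sphere (0 : E) 1 := by
        simp only [B, Metric.mem_ball, not_lt] at hxB
        exact le_antisymm hx hxB
      rw [hs x this, sub_self]
      exact if_neg hxB
  have hcd : ∀ x ∈ Metric.closedBall (0 : E) 1, ContDiffAt ℝ 1 (fun y => r y - y) x :=
    fun x hx => (hr x hx).sub contDiffAt_id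
  -- Lipschitz on the closed ball
  obtain ⟨K, hK⟩ : ∃ K : ℝ≥0, LipschitzOnWith K (fun y => r y - y)
      (Metric.closedBall (0 : E) 1) := by
    have hfd : ContinuousOn (fun x => fderiv ℝ (fun y => r y - y) x)
        (Metric.closedBall (0 : E) 1) :=
      fun x hx => ((hcd x hx).continuousAt_fderiv (by simp)).continuousWithinAt
    obtain ⟨C, hC⟩ := (isCompact_closedBall (0 : E) 1).exists_bound_of_continuousOn hfd
    refine ⟨C.toNNReal, Convex.lipschitzOnWith_of_nnnorm_fderiv_le
      (fun x hx => (hcd x hx).differentiableAt (by simp)) (fun x hx => ?_) (convex_closedBall _ _)⟩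
    exact NNReal.le_toNNReal_of_coe_le (hC x hx)
  have hgK : ∀ x ∈ Metric.closedBall (0 : E) 1, ∀ y, dist (g x) (g y) ≤ K * dist x y := by
    intro x hx y
    by_cases hy : y ∈ Metric.closedBall (0 : E) 1
    · rw [hgcB x hx, hgcB y hy]
      exact hK.dist_le_mul x hx y hy
    · obtain ⟨s, hs01, hs1⟩ : ∃ s ∈ Icc (0 : ℝ) 1, ‖AffineMap.lineMap x y s‖ = 1 := by
        have hc : Continuous fun s : ℝ => ‖AffineMap.lineMap x y s‖ :=
          (AffineMap.lineMap_continuous).norm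
        refine intermediate_value_Icc zero_le_one hc.continuousOn ⟨?_, ?_⟩
        · simpa using hx
        · simpa using (not_le.1 (fun h => hy (by simpa using h))).le
      have hz : AffineMap.lineMap x y s ∈ Metric.sphere (0 : E) 1 := by simpa using hs1
      have hz' := Metric.sphere_subset_closedBall hz
      have hgz : g (AffineMap.lineMap x y s) = 0 := by
        rw [hgcB _ hz', hs _ hz, sub_self]
      have hgy : g y = 0 := if_neg fun h => hy (Metric.ball_subset_closedBall h)
      rw [hgy, ← hgz, hgcB x hx, hgcB _ hz']
      refine (hK.dist_le_mul x hx _ hz').trans (mul_le_mul_of_nonneg_left ?_ K.2)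
      rw [dist_left_lineMap, Real.norm_of_nonneg hs01.1]
      exact mul_le_of_le_one_left dist_nonneg hs01.2
  have hglip : LipschitzWith K g := by
    refine LipschitzWith.of_dist_le_mul fun x y => ?_
    by_cases hx : x ∈ Metric.closedBall (0 : E) 1
    · exact hgK x hx y
    by_cases hy : y ∈ Metric.closedBall (0 : E) 1
    · rw [dist_comm, dist_comm x]
      exact hgK y hy x
    · have hgx : g x = 0 := if_neg fun h => hx (Metric.ball_subset_closedBall h)
      have hgy : g y = 0 := if_neg fun h => hy (Metric.ball_subset_closedBall h)
      rw [hgx, hgy, dist_self]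
      positivity
  have hsub := Metric.ball_subset_closedBall (x := (0 : E)) (ε := 1)
  have h_int := integral_det_one_add_fderiv_eq hglip (fun x hx => if_neg hx) fun x hx =>
    (((hcd x (hsub hx)).differentiableAt (by simp)).congr_of_eventuallyEq (hgB x hx))
  have hzero : ∀ x ∈ Metric.ball (0 : E) 1, (1 + fderiv ℝ g x).det = 0 := by
    intro x hx
    have hrd : DifferentiableAt ℝ r x := (hr x (hsub hx)).differentiableAt (by simp)
    have hfd : 1 + fderiv ℝ g x = fderiv ℝ r x := by
      rw [(hgB x hx).fderiv_eq]
      have := (hrd.hasFDerivAt.sub (hasFDerivAt_id x)).fderiv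
      rw [show (fun y => r y - y) = r - id from rfl, this]
      ext v
      simp
    rw [hfd]
    have horth : ∀ v, inner ℝ (r x) (fderiv ℝ r x v) = 0 := by
      intro v
      have h1 : HasFDerivAt (fun y => ‖r y‖ ^ 2) _ x := hrd.hasFDerivAt.norm_sq
      have h2 : (fun y => ‖r y‖ ^ 2) =ᶠ[𝓝 x] fun _ => (1 : ℝ) := by
        filter_upwards [Metric.isOpen_ball.mem_nhds hx] with y hy
        rw [hn y (hsub hy), one_pow]
      have h3 := h1.unique ((hasFDerivAt_const (1 : ℝ) x).congr_of_eventuallyEq h2)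
      have h4 := DFunLike.congr_fun h3 v
      simpa using h4
    by_contra hdet
    have hsurj : Function.Surjective (fderiv ℝ r x) := by
      exact (LinearMap.equivOfDetNeZero (fderiv ℝ r x : E →ₗ[ℝ] E) hdet).surjective
    obtain ⟨v, hv⟩ := hsurj (r x)
    have h5 := horth v
    rw [hv, real_inner_self_eq_norm_sq, hn x (hsub hx)] at h5
    norm_num at h5
  rw [setIntegral_congr_fun Metric.isOpen_ball.measurableSet hzero, integral_zero] at h_int
  have hpos : 0 < volume.real (Metric.ball (0 : E) 1) :=
    ENNReal.toReal_pos (Metric.measure_ball_pos volume 0 one_pos).ne' measure_ball_lt_top.ne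
  exact hpos.ne h_int

theorem exists_fixedPoint_of_contDiff {h : E → E} (hh : ContDiff ℝ 1 h) (hb : ∀ x, ‖h x‖ ≤ 1) :
    ∃ x, h x = x := by
  by_contra! hne
  let p : E → ℝ := fun x => inner ℝ x (x - h x)
  let D : E → ℝ := fun x => p x ^ 2 + ‖x - h x‖ ^ 2 * (1 - ‖x‖ ^ 2)
  let l : E → ℝ := fun x => (-p x + √(D x)) / ‖x - h x‖ ^ 2
  have hN : ∀ x, 0 < ‖x - h x‖ ^ 2 := fun x =>
    pow_pos (norm_pos_iff.2 (sub_ne_zero.2 (hne x).symm)) 2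
  have hp1 : ∀ x, ‖x‖ = 1 → 0 < p x := by
    intro x hx
    have h1 := norm_sub_sq_real x (h x)
    have h2 : p x = ‖x‖ ^ 2 - inner ℝ x (h x) := by
      simp only [p]
      rw [inner_sub_right, real_inner_self_eq_norm_sq]
    have h3 := hN x
    have h4 : ‖h x‖ ^ 2 ≤ 1 := pow_le_one₀ (norm_nonneg _) (hb x)
    rw [hx] at h1 h2
    linarith
  have hD : ∀ x ∈ Metric.closedBall (0 : E) 1, 0 < D x := by
    intro x hx
    rw [mem_closedBall_zero_iff] at hx
    rcases hx.lt_or_eq with hx | hx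
    · have : 0 < 1 - ‖x‖ ^ 2 := by
        have := norm_nonneg x
        nlinarith
      have := mul_pos (hN x) this
      simp only [D]
      positivity
    · have := pow_pos (hp1 x hx) 2
      simpa [D, hx] using this
  refine not_exists_retraction_onto_sphere (r := fun x => x + l x • (x - h x)) ?_ ?_ ?_
  · intro x hx
    have hd : ContDiffAt ℝ 1 (fun x => x - h x) x := contDiffAt_id.sub hh.contDiffAt
    have hpc : ContDiffAt ℝ 1 p x := contDiffAt_id.inner ℝ hd
    have hDc : ContDiffAt ℝ 1 D x :=
      (hpc.pow 2).add ((hd.norm_sq ℝ).mul (contDiffAt_const.sub (contDiffAt_id.norm_sq ℝ)))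
    have hlc : ContDiffAt ℝ 1 l x :=
      (hpc.neg.add (hDc.sqrt (hD x hx).ne')).div (hd.norm_sq ℝ) (hN x).ne'
    exact contDiffAt_id.add (hlc.smul hd)
  · intro x hx
    rw [mem_sphere_zero_iff_norm] at hx
    have : l x = 0 := by
      simp [l, D, hx, Real.sqrt_sq (hp1 x hx).le]
    simp [this]
  · intro x hx
    have h1 : l x * ‖x - h x‖ ^ 2 = -p x + √(D x) := div_mul_cancel₀ _ (hN x).ne'
    have h2 : √(D x) ^ 2 = D x := Real.sq_sqrt (hD x hx).le
    have h3 : ‖x + l x • (x - h x)‖ ^ 2 =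
        ‖x‖ ^ 2 + 2 * (l x * p x) + l x ^ 2 * ‖x - h x‖ ^ 2 := by
      rw [norm_add_sq_real, inner_smul_right, norm_smul, mul_pow, Real.norm_eq_abs, sq_abs]
    have h4 : ‖x + l x • (x - h x)‖ ^ 2 = 1 := by
      rw [h3]
      have h5 : √(D x) = l x * ‖x - h x‖ ^ 2 + p x := by linarith
      rw [h5] at h2
      have h6 : ‖x - h x‖ ^ 2 * (‖x‖ ^ 2 + 2 * (l x * p x) + l x ^ 2 * ‖x - h x‖ ^ 2) =
          ‖x - h x‖ ^ 2 * 1 := by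
        simp only [D] at h2
        linear_combination h2
      exact mul_left_cancel₀ (hN x).ne' h6
    exact (pow_eq_one_iff_of_nonneg (norm_nonneg _) two_ne_zero).1 h4

/-- **Brouwer's fixed point theorem** for bounded continuous self-maps of a Euclidean space. -/
theorem exists_fixedPoint_of_continuous_of_bounded {f : E → E} (hf : Continuous f) {R : ℝ}
    (hR : ∀ x, ‖f x‖ ≤ R) : ∃ x, f x = x := by
  wlog h1 : R = 1 generalizing f R
  · have hR0 : 0 ≤ R := (norm_nonneg _).trans (hR 0)
    have hS : 0 < R + 1 := by positivity
    obtain ⟨x, hx⟩ := this (f := fun x => (R + 1)⁻¹ • f ((R + 1) • x)) (R := 1) (by fun_prop)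
      (fun x => by
        rw [norm_smul, norm_inv, Real.norm_of_nonneg hS.le, inv_mul_le_iff₀ hS]
        linarith [hR ((R + 1) • x)]) rfl
    refine ⟨(R + 1) • x, ?_⟩
    conv_rhs => rw [← hx]
    rw [smul_inv_smul₀ hS.ne']
  subst h1
  by_contra! hne
  obtain ⟨x₀, -, hx₀⟩ := (isCompact_closedBall (0 : E) 1).exists_isMinOn ⟨0, by simp⟩
    (f := fun x => ‖f x - x‖) (by fun_prop)
  set η := ‖f x₀ - x₀‖ / 2 with hη
  have hη0 : 0 < η := half_pos (norm_pos_iff.2 (sub_ne_zero.2 (hne x₀)))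
  obtain ⟨g, hg, hgf, -⟩ := hf.exists_contDiff_approx 1 (ε := fun _ => η) continuous_const
    fun _ => hη0
  have hgn : ∀ x, ‖g x‖ ≤ 1 + η := fun x => by
    have h2 := hgf x
    rw [dist_eq_norm] at h2
    have h3 := norm_add_le (g x - f x) (f x)
    rw [sub_add_cancel] at h3
    linarith [hR x]
  have hS : 0 < 1 + η := by positivity
  have hb : ∀ x, ‖(1 + η)⁻¹ • g x‖ ≤ 1 := fun x => by
    rw [norm_smul, norm_inv, Real.norm_of_nonneg hS.le, inv_mul_le_iff₀ hS]
    linarith [hgn x]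
  obtain ⟨x, hx⟩ := exists_fixedPoint_of_contDiff (h := fun x => (1 + η)⁻¹ • g x)
    (contDiff_const.smul (by exact_mod_cast hg)) hb
  have hxb : x ∈ Metric.closedBall (0 : E) 1 := by
    rw [mem_closedBall_zero_iff, ← hx]
    exact hb x
  have h4 : 2 * η ≤ ‖f x - x‖ := by
    have : ‖f x₀ - x₀‖ ≤ ‖f x - x‖ := hx₀ hxb
    linarith
  have h5 : g x = (1 + η) • x := by
    rw [← hx]
    simp only [hx]
    conv_rhs => rw [← hx]
    rw [smul_inv_smul₀ hS.ne']
  have h6 : ‖g x - x‖ ≤ η := by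
    rw [h5, add_smul, one_smul, add_sub_cancel_left, norm_smul, Real.norm_of_nonneg hη0.le]
    rw [mem_closedBall_zero_iff] at hxb
    exact mul_le_of_le_one_right hη0.le hxb
  have h7 := hgf x
  rw [dist_comm, dist_eq_norm] at h7
  have h8 := norm_sub_le_norm_sub_add_norm_sub (f x) (g x) x
  linarith

end Brouwer

section Schauder

open Topology

/-- **Schauder's fixed point theorem** for continuous self-maps with relatively compact range. -/
theorem exists_fixedPoint_of_continuous_of_range_subset_isCompact {X : Type*}
    [NormedAddCommGroup X] [NormedSpace ℝ X] {f : X → X} (hf : Continuous f) {K : Set X}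
    (hK : IsCompact K) (hfK : ∀ x, f x ∈ K) : ∃ x, f x = x := by
  have approx : ∀ ε > 0, ∃ x, ‖f x - x‖ ≤ ε := by
    intro ε hε
    obtain ⟨t, htK, ht, hcov⟩ := hK.finite_cover_balls hε
    have : Fintype t := ht.fintype
    let q : t → X → ℝ := fun i x => max (ε - dist x i) 0
    have hq : ∀ i, Continuous (q i) := fun i => by fun_prop
    have hq0 : ∀ i x, 0 ≤ q i x := fun i x => le_max_right _ _
    have hqpos : ∀ x ∈ K, 0 < ∑ i, q i x := by
      intro x hx
      obtain ⟨y, hy, hxy⟩ := mem_iUnion₂.1 (hcov hx)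
      refine Finset.sum_pos' (fun i _ => hq0 i x) ⟨⟨y, hy⟩, Finset.mem_univ _, ?_⟩
      exact lt_max_of_lt_left (sub_pos.2 hxy)
    let L : EuclideanSpace ℝ t → X := fun w => ∑ i, w i • (i : X)
    have hL : Continuous L := by fun_prop
    let G : EuclideanSpace ℝ t → EuclideanSpace ℝ t := fun w =>
      WithLp.toLp 2 fun i => q i (f (L w)) / ∑ j, q j (f (L w))
    have hG : Continuous G := by
      refine (PiLp.continuous_toLp 2 _).comp (continuous_pi fun i => ?_)
      refine ((hq i).comp (hf.comp hL)).div ?_ fun w => (hqpos _ (hfK _)).ne'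
      exact continuous_finsetSum _ fun j _ => (hq j).comp (hf.comp hL)
    have hG1 : ∀ w i, 0 ≤ G w i ∧ G w i ≤ 1 := fun w i =>
      ⟨div_nonneg (hq0 i _) (hqpos _ (hfK _)).le,
        div_le_one_of_le₀ (Finset.single_le_sum (fun j _ => hq0 j _) (Finset.mem_univ i))
          (hqpos _ (hfK _)).le⟩
    obtain ⟨w, hw⟩ := exists_fixedPoint_of_continuous_of_bounded hG (R := √(Fintype.card t))
      fun w => by
        rw [EuclideanSpace.norm_eq]
        refine Real.sqrt_le_sqrt ?_
        calc ∑ i, ‖G w i‖ ^ 2 ≤ ∑ _i : t, (1 : ℝ) := Finset.sum_le_sum fun i _ => by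
              rw [Real.norm_of_nonneg (hG1 w i).1]
              exact pow_le_one₀ (hG1 w i).1 (hG1 w i).2
          _ = _ := by simp
    refine ⟨L w, ?_⟩
    set z := f (L w) with hz
    have hzpos := hqpos z (hfK _)
    have hwi : ∀ i, w i * ∑ j, q j z = q i z := fun i => by
      have : w i = q i z / ∑ j, q j z := by
        conv_lhs => rw [← hw]
      rw [this, div_mul_cancel₀ _ hzpos.ne']
    have h1 : (∑ j, q j z) • (z - L w) = ∑ j, q j z • (z - (j : X)) := by
      simp only [smul_sub, Finset.sum_sub_distrib, L, Finset.smul_sum, ← Finset.sum_smul]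
      congr 1
      refine Finset.sum_congr rfl fun i _ => ?_
      rw [smul_smul, mul_comm, hwi i]
    have h2 : (∑ j, q j z) * ‖z - L w‖ ≤ (∑ j, q j z) * ε := by
      rw [← Real.norm_of_nonneg hzpos.le, ← norm_smul, h1, Real.norm_of_nonneg hzpos.le,
        Finset.sum_mul]
      refine (norm_sum_le _ _).trans (Finset.sum_le_sum fun i _ => ?_)
      rw [norm_smul, Real.norm_of_nonneg (hq0 i z)]
      rcases (hq0 i z).eq_or_lt with h | h
      · rw [← h, zero_mul, zero_mul]
      · refine mul_le_mul_of_nonneg_left ?_ h.le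
        have : 0 < ε - dist z i := by
          rcases lt_max_iff.1 h with h | h
          · exact h
          · exact absurd h (lt_irrefl _)
        rw [← dist_eq_norm]
        linarith
    exact le_of_mul_le_mul_left h2 hzpos
  choose x hx using fun n : ℕ => approx (1 / ((n : ℝ) + 1)) (by positivity)
  obtain ⟨y, -, ψ, hψ, hlim⟩ := hK.tendsto_subseq fun n => hfK (x n)
  have h0 : Tendsto (fun n => f (x (ψ n)) - x (ψ n)) atTop (𝓝 0) := by
    refine squeeze_zero_norm (fun n => hx (ψ n)) ?_
    exact (tendsto_one_div_add_atTop_nhds_zero_nat (𝕜 := ℝ)).comp hψ.tendsto_atTop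
  have hxy : Tendsto (fun n => x (ψ n)) atTop (𝓝 y) := by
    simpa using hlim.sub h0
  exact ⟨y, tendsto_nhds_unique ((hf.tendsto y).comp hxy) hlim⟩

end Schauder


section Continuum

open Topology

/-- `Z` splits into two disjoint closed pieces, one bounded above and the other bounded below
with respect to the real-valued map `π`. -/
def SplitsAtInfinity {Y : Type*} [TopologicalSpace Y] (π : Y → ℝ) (Z : Set Y) : Prop :=
  ∃ P Q : Set Y, IsClosed P ∧ IsClosed Q ∧ Disjoint P Q ∧ P ∪ Q = Z ∧
    ∃ m : ℝ, (∀ p ∈ P, π p < m) ∧ ∀ p ∈ Q, -m < π p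

theorem SplitsAtInfinity.union {Y : Type*} [TopologicalSpace Y] {π : Y → ℝ} {A B : Set Y}
    (hA : SplitsAtInfinity π A) (hB : SplitsAtInfinity π B) (hAB : Disjoint A B) :
    SplitsAtInfinity π (A ∪ B) := by
  obtain ⟨P, Q, hP, hQ, hPQ, rfl, m, hm, hm'⟩ := hA
  obtain ⟨P', Q', hP', hQ', hPQ', rfl, k, hk, hk'⟩ := hB
  rw [disjoint_union_left, disjoint_union_right, disjoint_union_right] at hAB
  refine ⟨P ∪ P', Q ∪ Q', hP.union hP', hQ.union hQ', ?_, union_union_union_comm _ _ _ _,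
    max m k, ?_, ?_⟩
  · rw [disjoint_union_left, disjoint_union_right, disjoint_union_right]
    exact ⟨⟨hPQ, hAB.1.2⟩, hAB.2.1.symm, hPQ'⟩
  · rintro p (hp | hp)
    · exact lt_max_of_lt_left (hm p hp)
    · exact lt_max_of_lt_right (hk p hp)
  · rintro p (hp | hp)
    · linarith [hm' p hp, le_max_left m k]
    · linarith [hk' p hp, le_max_right m k]

theorem exists_splitsAtInfinity_of_iInter {Y ι : Type*} [TopologicalSpace Y] [T2Space Y]
    [NormalSpace Y] [Nonempty ι] {π : Y → ℝ} (hπ : Continuous π) {Z : ι → Set Y}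
    (hZ : ∀ i, IsClosed (Z i)) (hdir : Directed (· ⊇ ·) Z)
    (hcpt : ∀ i m, IsCompact (Z i ∩ {p | |π p| ≤ m})) (h : SplitsAtInfinity π (⋂ i, Z i)) :
    ∃ i, SplitsAtInfinity π (Z i) := by
  obtain ⟨P, Q, hP, hQ, hPQ, hPQZ, m, hm, hm'⟩ := h
  wlog hm0 : 0 ≤ m generalizing m
  · exact this |m| (fun p hp => (hm p hp).trans_le (le_abs_self m))
      (fun p hp => (neg_le_neg (le_abs_self m)).trans_lt (hm' p hp)) (abs_nonneg m)
  obtain ⟨U, V, hU, hV, hPU, hQV, hUV⟩ := normal_separation hP hQ hPQ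
  have hsub : ∀ x ∈ ⋂ i, Z i ∩ {p | |π p| ≤ m},
      (U ∩ {p | π p < m}) ∪ (V ∩ {p | -m < π p}) ∈ 𝓝 x := by
    intro x hx
    refine ((hU.inter (isOpen_lt hπ continuous_const)).union
      (hV.inter (isOpen_lt continuous_const hπ))).mem_nhds ?_
    have hx' : x ∈ ⋂ i, Z i := mem_iInter.2 fun i => (mem_iInter.1 hx i).1
    rw [← hPQZ] at hx'
    rcases hx' with hx' | hx'
    · exact Or.inl ⟨hPU hx', hm x hx'⟩
    · exact Or.inr ⟨hQV hx', hm' x hx'⟩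
  have hcl : ∀ i, IsClosed (Z i ∩ {p | |π p| ≤ m}) := fun i =>
    (hZ i).inter (isClosed_le hπ.abs continuous_const)
  obtain ⟨i, hi⟩ := exists_subset_nhds_of_isCompact' 
    (fun i j => (hdir i j).imp fun k hk =>
      ⟨inter_subset_inter_left _ hk.1, inter_subset_inter_left _ hk.2⟩)
    (fun i => hcpt i m) hcl hsub
  have hcov : ∀ x ∈ Z i, -m ≤ π x → π x ≤ m → x ∈ (U ∩ {p | π p < m}) ∪ (V ∩ {p | -m < π p}) :=
    fun x hx h1 h2 => hi ⟨hx, abs_le.2 ⟨h1, h2⟩⟩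
  refine ⟨i, Z i ∩ ({p | π p ≤ m} ∩ (V ∩ {p | -m < π p})ᶜ),
    Z i ∩ ({p | -m ≤ π p} ∩ (U ∩ {p | π p < m})ᶜ), ?_, ?_, ?_, ?_, m + 1, ?_, ?_⟩
  · exact (hZ i).inter ((isClosed_le hπ continuous_const).inter
      (hV.inter (isOpen_lt continuous_const hπ)).isClosed_compl)
  · exact (hZ i).inter ((isClosed_le continuous_const hπ).inter
      (hU.inter (isOpen_lt hπ continuous_const)).isClosed_compl)
  · rw [Set.disjoint_left]
    rintro x ⟨hx, h1, h2⟩ ⟨-, h3, h4⟩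
    rcases hcov x hx h3 h1 with h | h
    · exact h4 h
    · exact h2 h
  · rw [← inter_union_distrib_left, inter_eq_left]
    intro x hx
    by_cases h1 : π x ≤ m
    · by_cases h2 : x ∈ V ∩ {p | -m < π p}
      · exact Or.inr ⟨le_of_lt (show -m < π x from h2.2),
            fun h3 => Set.disjoint_left.1 hUV h3.1 h2.1⟩
      · exact Or.inl ⟨h1, h2⟩
    · by_cases h2 : -m ≤ π x
      · exact Or.inr ⟨h2, fun h3 => h1 (le_of_lt h3.2)⟩
      · exact Or.inl ⟨show π x ≤ m by linarith, fun h3 => h2 (le_of_lt h3.2)⟩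
  · rintro p ⟨-, h1, -⟩
    exact lt_of_le_of_lt h1 (lt_add_one m)
  · rintro p ⟨-, h1, -⟩
    have h1 : -m ≤ π p := h1
    linarith

theorem exists_connected_of_not_splitsAtInfinity {Y : Type*} [TopologicalSpace Y] [T2Space Y]
    [NormalSpace Y] {π : Y → ℝ} (hπ : Continuous π) {S : Set Y} (hS : IsClosed S)
    (hcpt : ∀ m, IsCompact (S ∩ {p | |π p| ≤ m})) (hns : ¬ SplitsAtInfinity π S) :
    ∃ Z ⊆ S, IsClosed Z ∧ IsConnected Z ∧ ∀ r, ∃ p ∈ Z, π p = r := by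
  obtain ⟨Z, ⟨hZS, hZ, hZns⟩, hmin⟩ := zorn_superset
    {Z : Set Y | Z ⊆ S ∧ IsClosed Z ∧ ¬ SplitsAtInfinity π Z} (by
      intro c hc hchain
      rcases c.eq_empty_or_nonempty with rfl | hne
      · exact ⟨S, ⟨subset_rfl, hS, hns⟩, by simp⟩
      have : Nonempty c := hne.to_subtype
      refine ⟨⋂ i : c, (i : Set Y), ⟨?_, ?_, ?_⟩,
          fun s hs => iInter_subset (fun i : c => (i : Set Y)) ⟨s, hs⟩⟩
      · obtain ⟨s, hs⟩ := hne
        exact (iInter_subset (fun i : c => (i : Set Y)) ⟨s, hs⟩).trans (hc hs).1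
      · exact isClosed_iInter fun i => (hc i.2).2.1
      · intro hsplit
        have hcpt' : ∀ (i : c) (m : ℝ), IsCompact ((i : Set Y) ∩ {p | |π p| ≤ m}) := fun i m =>
          (hcpt m).of_isClosed_subset
            ((hc i.2).2.1.inter (isClosed_le hπ.abs continuous_const))
            (inter_subset_inter_left _ (hc i.2).1)
        obtain ⟨i, hi⟩ := exists_splitsAtInfinity_of_iInter hπ (fun i : c => (hc i.2).2.1)
          (fun i j => (hchain.total i.2 j.2).elim (fun h => ⟨i, subset_rfl, h⟩)
            fun h => ⟨j, h, subset_rfl⟩) hcpt' hsplit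
        exact (hc i.2).2.2 hi)
  have hproj : ∀ r, ∃ p ∈ Z, π p = r := by
    intro r
    by_contra! hr
    refine hZns ⟨Z ∩ {p | π p ≤ r}, Z ∩ {p | r ≤ π p},
      hZ.inter (isClosed_le hπ continuous_const),
          hZ.inter (isClosed_le continuous_const hπ), ?_, ?_,
      |r| + 1, ?_, ?_⟩
    · rw [Set.disjoint_left]
      rintro x ⟨hx, h1⟩ ⟨-, h2⟩
      exact hr x hx (le_antisymm h1 h2)
    · rw [← inter_union_distrib_left, inter_eq_left]
      intro x _
      exact le_total (π x) r
    · rintro p ⟨-, h1⟩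
      have h1 : π p ≤ r := h1
      linarith [le_abs_self r]
    · rintro p ⟨-, h1⟩
      have h1 : r ≤ π p := h1
      linarith [neg_abs_le r]
  refine ⟨Z, hZS, hZ, ⟨?_, ?_⟩, hproj⟩
  · obtain ⟨p, hp, -⟩ := hproj 0
    exact ⟨p, hp⟩
  · rw [isPreconnected_iff_subset_of_fully_disjoint_closed hZ]
    intro A B hA hB hcov hAB
    have key : ∀ C : Set Y, IsClosed C → ¬ SplitsAtInfinity π (Z ∩ C) → Z ⊆ C := by
      intro C hC hCs
      exact (hmin ⟨inter_subset_left.trans hZS, hZ.inter hC, hCs⟩ inter_subset_left).trans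
        inter_subset_right
    by_cases h1 : SplitsAtInfinity π (Z ∩ A)
    · by_cases h2 : SplitsAtInfinity π (Z ∩ B)
      · refine absurd ?_ hZns
        have := h1.union h2 (hAB.mono inter_subset_right inter_subset_right)
        rwa [← inter_union_distrib_left, inter_eq_left.2 hcov] at this
      · exact Or.inr (key B hB h2)
    · exact Or.inl (key A hA h1)

theorem exists_connected_fixedPoints {X : Type*} [NormedAddCommGroup X] [NormedSpace ℝ X]
    {Ψ : ℝ × ℝ × X → X} (hΨ : Continuous Ψ)
    (hcpt : ∀ R : ℝ, ∃ K : Set X, IsCompact K ∧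
      ∀ l ∈ Icc (0 : ℝ) 1, ∀ s v, |s| ≤ R → ‖v‖ ≤ R → Ψ (l, s, v) ∈ K)
    {s₀ : ℝ} (h0 : ∀ v, Ψ (0, s₀, v) = 0)
    (hbd0 : ∃ B, ∀ l ∈ Icc (0 : ℝ) 1, ∀ v, Ψ (l, s₀, v) = v → ‖v‖ ≤ B)
    (hbd1 : ∀ M, ∃ B, ∀ s v, |s| ≤ M → Ψ (1, s, v) = v → ‖v‖ ≤ B) :
    ∃ Z : Set (ℝ × X), IsClosed Z ∧ IsConnected Z ∧ (∀ p ∈ Z, Ψ (1, p.1, p.2) = p.2) ∧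
      ∀ r, ∃ p ∈ Z, p.1 = r := by
  have hS : IsClosed {p : ℝ × X | Ψ (1, p.1, p.2) = p.2} :=
    isClosed_eq (by fun_prop) continuous_snd
  suffices h : (∀ m, IsCompact ({p : ℝ × X | Ψ (1, p.1, p.2) = p.2} ∩ {p | |p.1| ≤ m})) ∧
      ¬ SplitsAtInfinity Prod.fst {p : ℝ × X | Ψ (1, p.1, p.2) = p.2} by
    obtain ⟨Z, hZS, hZ, hZc, hZp⟩ :=
      exists_connected_of_not_splitsAtInfinity continuous_fst hS h.1 h.2
    exact ⟨Z, hZ, hZc, hZS, hZp⟩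
  constructor
  · intro m
    obtain ⟨B, hB⟩ := hbd1 m
    obtain ⟨K, hK, hKm⟩ := hcpt (max m B)
    refine ((isCompact_Icc (a := -m) (b := m)).prod hK).of_isClosed_subset
      (hS.inter (isClosed_le continuous_fst.abs continuous_const)) ?_
    rintro ⟨s, v⟩ ⟨h1, h2⟩
    have h1 : Ψ (1, s, v) = v := h1
    have h2 : |s| ≤ m := h2
    refine ⟨abs_le.1 h2, ?_⟩
    have := hKm 1 (by simp) s v (h2.trans (le_max_left _ _))
        ((hB s v h2 h1).trans (le_max_right _ _))
    rwa [h1] at this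
  · rintro ⟨P, Q, hP, hQ, hPQ, hPQS, m, hm, hm'⟩
    obtain ⟨g, hgP, hgQ, hg01⟩ := exists_continuous_zero_one_of_isClosed hP hQ hPQ
    set M : ℝ := |m| + |s₀| with hM
    have hM0 : 0 ≤ M := by positivity
    obtain ⟨B₀, hB₀⟩ := hbd0
    obtain ⟨B₁, hB₁⟩ := hbd1 (|s₀| + M)
    set B : ℝ := max (max B₀ B₁) 0 with hB
    have hB0 : 0 ≤ B := le_max_right _ _
    obtain ⟨K, hK, hKm⟩ := hcpt (max (|s₀| + M) (B + 1))
    -- retraction onto the closed ball of radius `B + 1`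
    let ret : X → X := fun v => ((B + 1) / max (B + 1) ‖v‖) • v
    have hmaxpos : ∀ v : X, 0 < max (B + 1) ‖v‖ := fun v => lt_max_of_lt_left (by linarith)
    have hret : Continuous ret :=
      (continuous_const.div (continuous_const.max continuous_norm) fun v => (hmaxpos v).ne').smul
        continuous_id
    have hretn : ∀ v, ‖ret v‖ ≤ B + 1 := fun v => by
      have h1 : 0 ≤ (B + 1) / max (B + 1) ‖v‖ := div_nonneg (by linarith) (hmaxpos v).le
      simp only [ret]
      rw [norm_smul, Real.norm_of_nonneg h1, div_mul_eq_mul_div, div_le_iff₀ (hmaxpos v)]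
      exact mul_le_mul_of_nonneg_left (le_max_right _ _) (by linarith)
    have hretid : ∀ v, ‖v‖ ≤ B + 1 → ret v = v := fun v hv => by
      simp only [ret]
      rw [max_eq_left hv, div_self (by linarith), one_smul]
    let c1 : ℝ → ℝ := fun a => max 0 (min 1 a)
    let cM : ℝ → ℝ := fun b => max (-M) (min M b)
    have hc1 : ∀ a, c1 a ∈ Icc (0 : ℝ) 1 :=
        fun a => ⟨le_max_left _ _, max_le zero_le_one (min_le_left _ _)⟩
    have hcM : ∀ b, cM b ∈ Icc (-M) M := fun b =>
      ⟨le_max_left _ _, max_le (by linarith) (min_le_left _ _)⟩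
    let α : X → ℝ := fun v => c1 (‖v‖ - B)
    let β : ℝ → X → ℝ := fun b v => (1 - α v) * (M * (1 - 2 * g (s₀ + b, v)))
    have hα : Continuous α := by fun_prop
    have hβ : Continuous fun p : ℝ × ℝ × X => β p.2.1 p.2.2 := by fun_prop
    have hβM : ∀ b v, |β b v| ≤ M := fun b v => by
      have h1 := hg01 (s₀ + b, v)
      have h2 := hc1 (‖v‖ - B)
      have h3 : |1 - α v| ≤ 1 :=
          abs_le.2 ⟨by simp only [α]; linarith [h2.2], by simp only [α]; linarith [h2.1]⟩
      have h4 : |1 - 2 * g (s₀ + b, v)| ≤ 1 := abs_le.2 ⟨by linarith [h1.2], by linarith [h1.1]⟩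
      simp only [β]
      rw [abs_mul, abs_mul, abs_of_nonneg hM0]
      calc |1 - α v| * (M * |1 - 2 * g (s₀ + b, v)|) ≤ 1 * (M * 1) := by gcongr
        _ = M := by ring
    -- the retraction of the half-plane `0 ≤ a` onto the tripod `a * b = 0`
    let Φ : ℝ × ℝ × X → ℝ × ℝ × X := fun p =>
      (max (α p.2.2 - |β p.2.1 p.2.2|) 0,
        max (β p.2.1 p.2.2 - α p.2.2) 0 - max (-β p.2.1 p.2.2 - α p.2.2) 0,
        Ψ (1 - c1 p.1, s₀ + cM p.2.1, ret p.2.2))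
    have hΦ : Continuous Φ := by fun_prop
    obtain ⟨⟨a, b, v⟩, hfix⟩ := exists_fixedPoint_of_continuous_of_range_subset_isCompact hΦ
      ((isCompact_Icc (a := (0 : ℝ)) (b := 1)).prod ((isCompact_Icc (a := -M) (b := M)).prod hK))
      (by
        rintro ⟨a, b, v⟩
        have h1 := hc1 (‖v‖ - B)
        have h2 := abs_le.1 (hβM b v)
        have h3 : 0 ≤ α v := h1.1
        have h4 : α v ≤ 1 := h1.2
        have h5 := abs_nonneg (β b v)
        refine ⟨⟨le_max_right _ _, max_le (by linarith) zero_le_one⟩, ⟨?_, ?_⟩, ?_⟩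
        · have h6 : max (-β b v - α v) 0 ≤ M := max_le (by linarith) hM0
          have h7 : 0 ≤ max (β b v - α v) 0 := le_max_right _ _
          show -M ≤ max (β b v - α v) 0 - max (-β b v - α v) 0
          linarith
        · have h6 : max (β b v - α v) 0 ≤ M := max_le (by linarith) hM0
          have h7 : 0 ≤ max (-β b v - α v) 0 := le_max_right _ _
          show max (β b v - α v) 0 - max (-β b v - α v) 0 ≤ M
          linarith
        · have h6 := hc1 a
          refine hKm _ ⟨by linarith [h6.2], by linarith [h6.1]⟩ _ _ ?_ ?_
          · refine le_max_of_le_left ((abs_add_le _ _).trans ?_)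
            gcongr
            exact abs_le.2 (hcM b)
          · exact le_max_of_le_right (hretn v))
    simp only [Φ, Prod.mk.injEq] at hfix
    obtain ⟨ha, hb, hv⟩ := hfix
    have hα01 : 0 ≤ α v ∧ α v ≤ 1 := hc1 (‖v‖ - B)
    have hβabs := abs_nonneg (β b v)
    have hβle := abs_le.1 (hβM b v)
    have ha01 : 0 ≤ a ∧ a ≤ 1 := by
      rw [← ha]
      exact ⟨le_max_right _ _, max_le (by linarith) zero_le_one⟩
    have hbM : -M ≤ b ∧ b ≤ M := by
      have h1 : max (-β b v - α v) 0 ≤ M := max_le (by linarith) hM0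
      have h2 : max (β b v - α v) 0 ≤ M := max_le (by linarith) hM0
      have h3 : 0 ≤ max (-β b v - α v) 0 := le_max_right _ _
      have h4 : 0 ≤ max (β b v - α v) 0 := le_max_right _ _
      exact ⟨by linarith, by linarith⟩
    have hc1a : c1 a = a := by
      simp only [c1]
      rw [min_eq_right ha01.2, max_eq_right ha01.1]
    have hcMb : cM b = b := by
      simp only [cM]
      rw [min_eq_right hbM.2, max_eq_right hbM.1]
    rw [hc1a, hcMb] at hv
    rcases le_or_gt (B + 1) ‖v‖ with hlarge | hsmall
    · have hα1 : α v = 1 := by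
        simp only [α, c1]
        rw [min_eq_left (by linarith), max_eq_right zero_le_one]
      have hβ0 : β b v = 0 := by simp only [β, hα1, sub_self, zero_mul]
      rw [hα1, hβ0] at ha hb
      norm_num at ha hb
      rw [← ha, ← hb, sub_self, add_zero, h0] at hv
      rw [← hv, norm_zero] at hlarge
      linarith
    · rw [hretid v hsmall.le] at hv
      have hvB : ‖v‖ ≤ B := by
        rcases le_or_gt (α v) |β b v| with h | h
        · rw [max_eq_right (by linarith)] at ha
          rw [← ha, sub_zero] at hv
          refine (hB₁ _ _ ?_ hv).trans ((le_max_right _ _).trans (le_max_left _ _))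
          exact (abs_add_le _ _).trans (add_le_add_right (abs_le.2 hbM) _)
        · have h1 := abs_lt.1 h
          rw [max_eq_right (by linarith), max_eq_right (by linarith), sub_zero] at hb
          rw [← hb, add_zero] at hv
          exact (hB₀ _ ⟨by linarith, by linarith⟩ _ hv).trans
            ((le_max_left _ _).trans (le_max_left _ _))
      have hα0 : α v = 0 := by
        simp only [α, c1]
        exact max_eq_left ((min_le_right _ _).trans (by linarith))
      rw [hα0, sub_zero, sub_zero, ← posPart_def, ← negPart_def, posPart_sub_negPart] at hb
      rw [hα0, max_eq_right (by linarith)] at ha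
      rw [← ha, sub_zero] at hv
      have hmem : (s₀ + b, v) ∈ P ∪ Q := by
        rw [hPQS]
        exact hv
      simp only [β, hα0] at hb
      rcases hmem with h | h
      · have h1 : s₀ + b < m := hm _ h
        rw [show g (s₀ + b, v) = 0 from hgP h] at hb
        linarith [le_abs_self m, neg_abs_le s₀]
      · have h1 : -m < s₀ + b := hm' _ h
        rw [show g (s₀ + b, v) = 1 from hgQ h] at hb
        linarith [le_abs_self m, le_abs_self s₀]

end Continuum

section Operators

open Topology

theorem isCompact_setOf_dist_le {I : Type*} [TopologicalSpace I] [CompactSpace I] (t₀ : I)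
    {Γ : I → ℝ} (hΓ : Continuous Γ) :
    IsCompact {h : C(I, ℝ) | h t₀ = 0 ∧ ∀ t t', |h t - h t'| ≤ |Γ t - Γ t'|} := by
  have hmod : ∀ f : I → ℝ, (∀ t t', |f t - f t'| ≤ |Γ t - Γ t'|) → Continuous f := by
    intro f hf
    refine continuous_iff_continuousAt.2 fun t => ?_
    rw [ContinuousAt, tendsto_iff_dist_tendsto_zero]
    refine squeeze_zero (fun _ => dist_nonneg) (fun t' => hf t' t) ?_
    have := ((hΓ.sub (continuous_const (y := Γ t))).abs).tendsto t
    simpa using this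
  refine ArzelaAscoli.isCompact_of_equicontinuous _ ?_ ?_
  · have himg : ContinuousMap.toFun ''
        {h : C(I, ℝ) | h t₀ = 0 ∧ ∀ t t', |h t - h t'| ≤ |Γ t - Γ t'|} =
        {f : I → ℝ | f t₀ = 0 ∧ ∀ t t', |f t - f t'| ≤ |Γ t - Γ t'|} := by
      ext f
      constructor
      · rintro ⟨h, hh, rfl⟩
        exact hh
      · intro hf
        exact ⟨⟨f, hmod f hf.2⟩, hf, rfl⟩
    rw [himg]
    refine (isCompact_univ_pi fun t =>
        isCompact_Icc (a := -|Γ t - Γ t₀|) (b := |Γ t - Γ t₀|)).of_isClosed_subset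
      ?_ ?_
    · refine (isClosed_eq (continuous_apply t₀) continuous_const).inter ?_
      have : {f : I → ℝ | ∀ t t', |f t - f t'| ≤ |Γ t - Γ t'|} =
          ⋂ t, ⋂ t', {f : I → ℝ | |f t - f t'| ≤ |Γ t - Γ t'|} := by
        ext f
        simp
      change IsClosed {f : I → ℝ | ∀ t t', |f t - f t'| ≤ |Γ t - Γ t'|}
      rw [this]
      exact isClosed_iInter fun t => isClosed_iInter fun t' =>
        isClosed_le ((continuous_apply t).sub (continuous_apply t')).abs continuous_const
    · rintro f ⟨h0, hf⟩ t -
      have := hf t t₀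
      rw [h0, sub_zero] at this
      exact abs_le.1 this
  · intro t
    rw [Metric.equicontinuousAt_iff_right]
    intro ε hε
    have h1 : Tendsto (fun t' => |Γ t - Γ t'|) (𝓝 t) (𝓝 0) := by
      have := ((continuous_const (y := Γ t)).sub hΓ).abs.tendsto t
      simpa using this
    filter_upwards [h1.eventually (gt_mem_nhds hε)] with t' ht' h
    exact (h.2.2 t t').trans_lt ht'

/-- The nonlinear solution operator `h ↦ φ⁻¹(c + h)`, where `c` is chosen so that the result has
zero mean. -/
theorem exists_continuous_zero_mean_inverse {T : ℝ} (hT : 0 < T) {φ : ℝ → ℝ}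
    (hφmono : StrictMono φ) (hφsurj : Function.Surjective φ) (hφ0 : φ 0 = 0) :
    ∃ A : C(Icc (0 : ℝ) T, ℝ) → C(Icc (0 : ℝ) T, ℝ), Continuous A ∧ A 0 = 0 ∧ ∀ h,
      (∫ t in (0 : ℝ)..T, IccExtend hT.le (A h) t) = 0 ∧ ∃ c, ∀ t, φ (A h t) = c + h t := by
  let e := hφmono.orderIsoOfSurjective φ hφsurj
  let ψ : ℝ → ℝ := e.symm
  have hψc : Continuous ψ := e.symm.continuous
  have hψm : StrictMono ψ := e.symm.strictMono
  have hφψ : ∀ x, φ (ψ x) = x := fun x => e.apply_symm_apply x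
  have hψ0 : ψ 0 = 0 := hφmono.injective (by rw [hφψ, hφ0])
  let G : C(Icc (0 : ℝ) T, ℝ) → ℝ → ℝ := fun h c =>
    ∫ t in (0 : ℝ)..T, ψ (c + IccExtend hT.le h t)
  have hext : ∀ h : C(Icc (0 : ℝ) T, ℝ), Continuous (IccExtend hT.le h) := fun h =>
    h.continuous.Icc_extend'
  have hcont : ∀ h : C(Icc (0 : ℝ) T, ℝ), ∀ c, Continuous fun t => ψ (c + IccExtend hT.le h t) :=
    fun h c => hψc.comp (continuous_const.add (hext h))
  have hlt : ∀ (h k : C(Icc (0 : ℝ) T, ℝ)) (c d : ℝ), (∀ t, c + h t < d + k t) → G h c < G k d := by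
    intro h k c d hlt
    have hlt' : ∀ t, ψ (c + IccExtend hT.le h t) < ψ (d + IccExtend hT.le k t) :=
      fun t => hψm (hlt _)
    exact intervalIntegral.integral_lt_integral_of_continuousOn_of_le_of_exists_lt hT
      (hcont h c).continuousOn (hcont k d).continuousOn (fun t _ => (hlt' t).le)
      ⟨0, ⟨le_rfl, hT.le⟩, hlt' 0⟩
  have hex : ∀ h, ∃ c, G h c = 0 := by
    intro h
    have hGc : Continuous (G h) := by
      refine intervalIntegral.continuous_parametric_intervalIntegral_of_continuous' ?_ 0 T
      exact hψc.comp (continuous_fst.add ((hext h).comp continuous_snd))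
    have hb : ∀ t, |IccExtend hT.le h t| ≤ ‖h‖ := fun t => h.norm_coe_le_norm _
    have h1 : G h (-‖h‖) ≤ 0 := by
      rw [← neg_nonneg, ← intervalIntegral.integral_neg]
      refine intervalIntegral.integral_nonneg_of_forall hT.le fun t => neg_nonneg.2 ?_
      exact (hψm.monotone (by linarith [(abs_le.1 (hb t)).2])).trans_eq hψ0
    have h2 : 0 ≤ G h ‖h‖ := by
      refine intervalIntegral.integral_nonneg_of_forall hT.le fun t => ?_
      exact hψ0.symm.trans_le (hψm.monotone (by linarith [(abs_le.1 (hb t)).1]))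
    obtain ⟨c, -, hc⟩ :=
        intermediate_value_Icc (by linarith [norm_nonneg h]) hGc.continuousOn ⟨h1, h2⟩
    exact ⟨c, hc⟩
  choose c hc using hex
  have hcl : ∀ h k, c h ≤ c k + ‖h - k‖ := by
    intro h k
    by_contra! hlt'
    have := hlt k h (c k) (c h) fun t => by
      have := (abs_le.1 ((h - k).norm_coe_le_norm t)).1
      rw [ContinuousMap.sub_apply] at this
      linarith
    rw [hc, hc] at this
    exact lt_irrefl _ this
  have hcc : Continuous c := by
    refine (LipschitzWith.of_dist_le_mul (K := 1) fun h k => ?_).continuous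
    rw [NNReal.coe_one, one_mul, Real.dist_eq, dist_eq_norm, abs_le]
    have h1 := hcl h k
    have h2 := hcl k h
    rw [norm_sub_rev] at h2
    constructor <;> linarith
  refine ⟨fun h => (⟨ψ, hψc⟩ : C(ℝ, ℝ)).comp (ContinuousMap.const (Icc (0 : ℝ) T) (c h) + h),
    ?_, ?_, fun h => ⟨hc h, c h, fun t => hφψ _⟩⟩
  · refine (ContinuousMap.continuous_postcomp _).comp (Continuous.add ?_ continuous_id)
    exact ContinuousMap.continuous_const'.comp hcc
  · have hc0 : c 0 = 0 := by
      have h0 : G 0 0 = 0 := by simp [G, hψ0, IccExtend]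
      rcases lt_trichotomy (c 0) 0 with h | h | h
      · have := hlt 0 0 (c 0) 0 fun t => by simpa using h
        rw [hc, h0] at this
        exact absurd this (lt_irrefl _)
      · exact h
      · have := hlt 0 0 0 (c 0) fun t => by simpa using h
        rw [hc, h0] at this
        exact absurd this (lt_irrefl _)
    ext t
    simp [hc0, hψ0]

/-- The primitive with zero mean over `[0,T]` of a continuous function. -/
def meanZeroPrimitive (T : ℝ) (v : ℝ → ℝ) (t : ℝ) : ℝ :=
  (∫ τ in (0 : ℝ)..t, v τ) - (1 / T) * ∫ s in (0 : ℝ)..T, ∫ τ in (0 : ℝ)..s, v τ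

theorem hasDerivAt_meanZeroPrimitive (T : ℝ) {v : ℝ → ℝ} (hv : Continuous v) (t : ℝ) :
    HasDerivAt (meanZeroPrimitive T v) (v t) t :=
  (hv.integral_hasStrictDerivAt 0 t).hasDerivAt.sub_const _

theorem continuous_meanZeroPrimitive (T : ℝ) {v : ℝ → ℝ} (hv : Continuous v) :
    Continuous (meanZeroPrimitive T v) :=
  continuous_iff_continuousAt.2 fun t => (hasDerivAt_meanZeroPrimitive T hv t).continuousAt

theorem setIntegral_meanZeroPrimitive {T : ℝ} (hT : 0 < T) {v : ℝ → ℝ} (hv : Continuous v) :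
    ∫ t in Icc (0 : ℝ) T, meanZeroPrimitive T v t = 0 := by
  have hc : Continuous fun t => ∫ τ in (0 : ℝ)..t, v τ :=
    intervalIntegral.continuous_primitive (fun a b => hv.intervalIntegrable a b) 0
  rw [integral_Icc_eq_integral_Ioc, ← intervalIntegral.integral_of_le hT.le]
  simp only [meanZeroPrimitive]
  rw [intervalIntegral.integral_sub (hc.intervalIntegrable _ _) (by simp),
    intervalIntegral.integral_const, smul_eq_mul]
  field_simp
  ring

theorem abs_meanZeroPrimitive_le {T : ℝ} (hT : 0 < T) {v : ℝ → ℝ} {B : ℝ}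
    (hB : ∀ t, |v t| ≤ B) {t : ℝ} (ht : t ∈ Icc (0 : ℝ) T) :
    |meanZeroPrimitive T v t| ≤ 2 * T * B := by
  have hB0 : 0 ≤ B := (abs_nonneg _).trans (hB 0)
  have h1 : ∀ s ∈ Icc (0 : ℝ) T, |∫ τ in (0 : ℝ)..s, v τ| ≤ B * T := by
    intro s hs
    have := intervalIntegral.norm_integral_le_of_norm_le_const (a := 0) (b := s) (f := v)
      (fun x _ => hB x)
    rw [sub_zero, abs_of_nonneg hs.1] at this
    exact this.trans (mul_le_mul_of_nonneg_left hs.2 hB0)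
  have h2 := intervalIntegral.norm_integral_le_of_norm_le_const (a := 0) (b := T)
    (f := fun s => ∫ τ in (0 : ℝ)..s, v τ) (C := B * T) fun x hx => by
      rw [uIoc_of_le hT.le] at hx
      exact h1 x ⟨hx.1.le, hx.2⟩
  rw [sub_zero, abs_of_pos hT] at h2
  have h3 : |(1 / T) * ∫ s in (0 : ℝ)..T, ∫ τ in (0 : ℝ)..s, v τ| ≤ B * T := by
    rw [abs_mul, abs_of_pos (one_div_pos.2 hT), one_div, inv_mul_le_iff₀ hT]
    exact h2.trans (by linarith)
  calc |meanZeroPrimitive T v t| ≤ _ := abs_sub _ _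
    _ ≤ 2 * T * B := by linarith [h1 t ht]

theorem meanZeroPrimitive_sub (T : ℝ) {v w : ℝ → ℝ} (hv : Continuous v) (hw : Continuous w)
    (t : ℝ) : meanZeroPrimitive T v t - meanZeroPrimitive T w t =
      meanZeroPrimitive T (fun s => v s - w s) t := by
  have hc : ∀ {u : ℝ → ℝ}, Continuous u → Continuous fun t => ∫ τ in (0 : ℝ)..t, u τ := fun hu =>
    intervalIntegral.continuous_primitive (fun a b => hu.intervalIntegrable a b) 0
  have h1 : ∀ s, ∫ τ in (0 : ℝ)..s, (v τ - w τ) =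
      (∫ τ in (0 : ℝ)..s, v τ) - ∫ τ in (0 : ℝ)..s, w τ := fun s =>
    intervalIntegral.integral_sub (hv.intervalIntegrable _ _) (hw.intervalIntegrable _ _)
  simp only [meanZeroPrimitive, h1]
  rw [intervalIntegral.integral_sub ((hc hv).intervalIntegrable _ _)
    ((hc hw).intervalIntegrable _ _)]
  ring

end Operators

section Nemytskii

open Topology

theorem CaratheodoryF.aestronglyMeasurable_comp {T : ℝ} {F : ℝ → ℝ → ℝ → ℝ}
    (hF : CaratheodoryF T F) {x y : ℝ → ℝ} (hx : Continuous x) (hy : Continuous y) :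
    AEStronglyMeasurable (fun t => F t (x t) (y t)) (muT T) := by
  classical
  let bad : Set ℝ := {t | ¬ Continuous fun p : ℝ × ℝ => F t p.1 p.2}
  let N : Set ℝ := toMeasurable (muT T) bad
  have hN : MeasurableSet N := measurableSet_toMeasurable _ _
  have hN0 : muT T N = 0 := by
    rw [measure_toMeasurable]
    exact hF.2.1
  let u : ℝ × ℝ → ℝ → ℝ := fun p => Nᶜ.indicator fun t => F t p.1 p.2
  have hu : Measurable (Function.uncurry u) := by
    refine measurable_uncurry_of_continuous_of_measurable (fun t => ?_) (fun p => ?_)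
    · by_cases ht : t ∈ N
      · simpa [u, ht] using continuous_const
      · have : Continuous fun p : ℝ × ℝ => F t p.1 p.2 := by
          by_contra h
          exact ht (subset_toMeasurable (muT T) bad h)
        simpa [u, ht] using this
    · exact (hF.1 p.1 p.2).indicator hN.compl
  have hm : Measurable fun t => u (x t, y t) t :=
    hu.comp ((hx.measurable.prodMk hy.measurable).prodMk measurable_id)
  refine hm.aestronglyMeasurable.congr ?_
  have : ∀ᵐ t ∂(muT T), t ∉ N := by
    rw [ae_iff]
    simpa using hN0
  filter_upwards [this] with t ht
  simp [u, ht]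

/-- The primitive vanishing at `0` of `g` minus its mean over `[0,T]`. -/
def centeredPrimitive (T : ℝ) (g : ℝ → ℝ) (t : ℝ) : ℝ :=
  ∫ τ in (0 : ℝ)..t, (g τ - (1 / T) * ∫ ξ in Icc (0 : ℝ) T, g ξ)

theorem intervalIntegrable_of_integrableOn_Icc {T : ℝ} {g : ℝ → ℝ}
    (hg : IntegrableOn g (Icc (0 : ℝ) T)) {a b : ℝ} (ha : a ∈ Icc (0 : ℝ) T)
    (hb : b ∈ Icc (0 : ℝ) T) : IntervalIntegrable g volume a b :=
  (hg.mono_set (uIcc_subset_Icc ha hb)).intervalIntegrable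

theorem integrableOn_sub_mean {T : ℝ} {g : ℝ → ℝ} (hg : IntegrableOn g (Icc (0 : ℝ) T)) :
    IntegrableOn (fun τ => g τ - (1 / T) * ∫ ξ in Icc (0 : ℝ) T, g ξ) (Icc (0 : ℝ) T) :=
  hg.sub (integrableOn_const (by simp))

theorem centeredPrimitive_right {T : ℝ} (hT : 0 < T) {g : ℝ → ℝ}
    (hg : IntegrableOn g (Icc (0 : ℝ) T)) : centeredPrimitive T g T = 0 := by
  have h0 : (0 : ℝ) ∈ Icc (0 : ℝ) T := ⟨le_rfl, hT.le⟩
  have h1 : T ∈ Icc (0 : ℝ) T := ⟨hT.le, le_rfl⟩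
  rw [centeredPrimitive, intervalIntegral.integral_sub
    (intervalIntegrable_of_integrableOn_Icc hg h0 h1) (by simp), intervalIntegral.integral_const,
    integral_Icc_eq_integral_Ioc, ← intervalIntegral.integral_of_le hT.le, smul_eq_mul]
  field_simp
  ring

theorem continuousOn_primitive_of_integrableOn_Icc {T : ℝ} (hT : 0 < T) {g : ℝ → ℝ}
    (hg : IntegrableOn g (Icc (0 : ℝ) T)) :
    ContinuousOn (fun t => ∫ τ in (0 : ℝ)..t, g τ) (Icc (0 : ℝ) T) := by
  have := intervalIntegral.continuousOn_primitive_interval (a := 0) (b := T) (f := g)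
    (μ := volume) (by rwa [uIcc_of_le hT.le])
  rwa [uIcc_of_le hT.le] at this

theorem abs_centeredPrimitive_sub_le {T : ℝ} (hT : 0 < T) {g k : ℝ → ℝ}
    (hg : IntegrableOn g (Icc (0 : ℝ) T)) (hk : IntegrableOn k (Icc (0 : ℝ) T)) {t : ℝ}
    (ht : t ∈ Icc (0 : ℝ) T) :
    |centeredPrimitive T g t - centeredPrimitive T k t| ≤
      2 * ∫ τ in Icc (0 : ℝ) T, |g τ - k τ| := by
  have h0 : (0 : ℝ) ∈ Icc (0 : ℝ) T := ⟨le_rfl, hT.le⟩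
  have hgi := intervalIntegrable_of_integrableOn_Icc hg h0 ht
  have hki := intervalIntegrable_of_integrableOn_Icc hk h0 ht
  have heq : centeredPrimitive T g t - centeredPrimitive T k t =
      (∫ τ in (0 : ℝ)..t, (g τ - k τ)) - t * ((1 / T) * ∫ ξ in Icc (0 : ℝ) T, (g ξ - k ξ)) := by
    rw [centeredPrimitive, centeredPrimitive, intervalIntegral.integral_sub hgi (by simp),
      intervalIntegral.integral_sub hki (by simp), intervalIntegral.integral_sub hgi hki,
      integral_sub hg hk, intervalIntegral.integral_const, intervalIntegral.integral_const]
    simp only [smul_eq_mul]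
    ring
  have h1 : |∫ τ in (0 : ℝ)..t, (g τ - k τ)| ≤ ∫ τ in Icc (0 : ℝ) T, |g τ - k τ| := by
    refine (intervalIntegral.abs_integral_le_integral_abs ht.1).trans ?_
    rw [intervalIntegral.integral_of_le ht.1]
    exact setIntegral_mono_set (hg.sub hk).abs (Eventually.of_forall fun _ => abs_nonneg _)
      (Ioc_subset_Icc_self.trans (Icc_subset_Icc le_rfl ht.2)).eventuallyLE
  have h2 : |∫ τ in Icc (0 : ℝ) T, (g τ - k τ)| ≤ ∫ τ in Icc (0 : ℝ) T, |g τ - k τ| :=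
    abs_integral_le_integral_abs
  have h3 : |t * ((1 / T) * ∫ ξ in Icc (0 : ℝ) T, (g ξ - k ξ))| ≤
      ∫ τ in Icc (0 : ℝ) T, |g τ - k τ| := by
    rw [← mul_assoc, abs_mul, mul_one_div, abs_of_nonneg (div_nonneg ht.1 hT.le)]
    exact (mul_le_of_le_one_left (abs_nonneg _) ((div_le_one hT).2 ht.2)).trans h2
  rw [heq]
  refine (abs_sub _ _).trans ?_
  linarith

theorem abs_centeredPrimitive_increment_le {T : ℝ} (hT : 0 < T) {g γ : ℝ → ℝ}
    (hg : IntegrableOn g (Icc (0 : ℝ) T)) (hγ : IntegrableOn γ (Icc (0 : ℝ) T))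
    (hle : ∀ᵐ t ∂(muT T), |g t| ≤ γ t) {t t' : ℝ} (ht : t ∈ Icc (0 : ℝ) T)
    (ht' : t' ∈ Icc (0 : ℝ) T) :
    |centeredPrimitive T g t - centeredPrimitive T g t'| ≤
      |(∫ τ in (0 : ℝ)..t, (γ τ + (1 / T) * ∫ ξ in Icc (0 : ℝ) T, γ ξ)) -
        ∫ τ in (0 : ℝ)..t', (γ τ + (1 / T) * ∫ ξ in Icc (0 : ℝ) T, γ ξ)| := by
  have h0 : (0 : ℝ) ∈ Icc (0 : ℝ) T := ⟨le_rfl, hT.le⟩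
  have hgm := integrableOn_sub_mean hg
  have hγm : IntegrableOn (fun τ => γ τ + (1 / T) * ∫ ξ in Icc (0 : ℝ) T, γ ξ) (Icc (0 : ℝ) T) :=
    hγ.add (integrableOn_const (by simp))
  rw [centeredPrimitive, centeredPrimitive, intervalIntegral.integral_interval_sub_left
    (intervalIntegrable_of_integrableOn_Icc hgm h0 ht)
    (intervalIntegrable_of_integrableOn_Icc hgm h0 ht'),
    intervalIntegral.integral_interval_sub_left
    (intervalIntegrable_of_integrableOn_Icc hγm h0 ht)
    (intervalIntegrable_of_integrableOn_Icc hγm h0 ht')]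
  have hmean : |∫ ξ in Icc (0 : ℝ) T, g ξ| ≤ ∫ ξ in Icc (0 : ℝ) T, γ ξ := by
    have := norm_integral_le_of_norm_le (f := g) hγ hle
    rwa [Real.norm_eq_abs] at this
  refine intervalIntegral.norm_integral_le_abs_of_norm_le (E := ℝ) ?_
    (intervalIntegrable_of_integrableOn_Icc hγm ht' ht)
  have hsub : uIoc t' t ⊆ Icc (0 : ℝ) T := uIoc_subset_uIcc.trans (uIcc_subset_Icc ht' ht)
  filter_upwards [ae_restrict_of_ae_restrict_of_subset hsub hle] with τ hτ
  refine (abs_sub _ _).trans (add_le_add hτ ?_)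
  rw [abs_mul, abs_of_pos (one_div_pos.2 hT)]
  exact mul_le_mul_of_nonneg_left hmean (one_div_pos.2 hT).le

/-- The superposition operator associated with `F`, in terms of the mean value `s` and the
derivative `v` of the unknown. -/
def superposition {T : ℝ} (hT : 0 < T) (F : ℝ → ℝ → ℝ → ℝ) (p : ℝ × C(Icc (0 : ℝ) T, ℝ))
    (t : ℝ) : ℝ :=
  F t (p.1 + meanZeroPrimitive T (IccExtend hT.le p.2) t) (IccExtend hT.le p.2 t)

theorem continuous_IccExtend_coe {T : ℝ} (hT : 0 < T) (v : C(Icc (0 : ℝ) T, ℝ)) :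
    Continuous (IccExtend hT.le v) :=
  v.continuous.Icc_extend'

theorem exists_superposition_bound {T : ℝ} (hT : 0 < T) {F : ℝ → ℝ → ℝ → ℝ}
    (hF : CaratheodoryF T F) (R : ℝ) :
    ∃ γ : ℝ → ℝ, IntegrableOn γ (Icc (0 : ℝ) T) ∧ ∀ p : ℝ × C(Icc (0 : ℝ) T, ℝ),
      |p.1| ≤ R → ‖p.2‖ ≤ R → ∀ᵐ t ∂(muT T), |superposition hT F p t| ≤ γ t := by
  have hR : 0 ≤ 2 * T * |R| := by positivity
  obtain ⟨γ, hγ, hγF⟩ := hF.2.2 (|R| + 2 * T * |R| + 1) (by positivity)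
  refine ⟨γ, hγ, fun p hs hv => ?_⟩
  have hR' := le_abs_self R
  have hb : ∀ t, |IccExtend hT.le p.2 t| ≤ |R| := fun t =>
    ((p.2.norm_coe_le_norm _).trans hv).trans hR'
  have hmem : ∀ᵐ t ∂(muT T), t ∈ Icc (0 : ℝ) T := ae_restrict_mem measurableSet_Icc
  filter_upwards [hγF, hmem] with t ht htm
  refine ht _ _ ?_ ?_
  · have h1 := abs_meanZeroPrimitive_le hT hb htm
    have h2 := abs_add_le p.1 (meanZeroPrimitive T (IccExtend hT.le p.2) t)
    linarith
  · linarith [hb t]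

theorem integrableOn_superposition {T : ℝ} (hT : 0 < T) {F : ℝ → ℝ → ℝ → ℝ}
    (hF : CaratheodoryF T F) (p : ℝ × C(Icc (0 : ℝ) T, ℝ)) :
    IntegrableOn (superposition hT F p) (Icc (0 : ℝ) T) := by
  obtain ⟨γ, hγ, hle⟩ := exists_superposition_bound hT hF ‖p‖
  refine Integrable.mono' hγ ?_ (hle p (norm_fst_le p) (norm_snd_le p))
  have hc := continuous_IccExtend_coe hT p.2
  exact hF.aestronglyMeasurable_comp (continuous_const.add (continuous_meanZeroPrimitive T hc)) hc

theorem tendsto_integral_abs_superposition_sub {T : ℝ} (hT : 0 < T) {F : ℝ → ℝ → ℝ → ℝ}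
    (hF : CaratheodoryF T F) (p : ℝ × C(Icc (0 : ℝ) T, ℝ)) :
    Tendsto (fun q => ∫ t in Icc (0 : ℝ) T, |superposition hT F q t - superposition hT F p t|)
      (𝓝 p) (𝓝 0) := by
  obtain ⟨γ, hγ, hle⟩ := exists_superposition_bound hT hF (‖p‖ + 1)
  have hnear : ∀ᶠ q in 𝓝 p, ‖q‖ ≤ ‖p‖ + 1 :=
    (continuous_norm.tendsto p).eventually (ge_mem_nhds (lt_add_one _))
  have hlim : Tendsto (fun q => ∫ t in Icc (0 : ℝ) T,
      |superposition hT F q t - superposition hT F p t|) (𝓝 p)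
      (𝓝 (∫ t in Icc (0 : ℝ) T, (0 : ℝ))) := by
    refine tendsto_integral_filter_of_dominated_convergence (fun t => γ t + γ t) ?_ ?_
      (hγ.add hγ) ?_
    · exact Eventually.of_forall fun q => ((integrableOn_superposition hT hF q).sub
        (integrableOn_superposition hT hF p)).abs.aestronglyMeasurable
    · filter_upwards [hnear] with q hq
      have h1 := hle q ((norm_fst_le q).trans hq) ((norm_snd_le q).trans hq)
      have hp : ‖p‖ ≤ ‖p‖ + 1 := by linarith
      have h2 := hle p ((norm_fst_le p).trans hp) ((norm_snd_le p).trans hp)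
      filter_upwards [h1, h2] with t ht1 ht2
      rw [Real.norm_eq_abs, abs_abs]
      exact (abs_sub _ _).trans (add_le_add ht1 ht2)
    · have hmem : ∀ᵐ t ∂(muT T), t ∈ Icc (0 : ℝ) T := ae_restrict_mem measurableSet_Icc
      filter_upwards [hF.2.1, hmem] with t hcont htm
      have hv : Tendsto (fun q : ℝ × C(Icc (0 : ℝ) T, ℝ) => IccExtend hT.le q.2 t) (𝓝 p)
          (𝓝 (IccExtend hT.le p.2 t)) :=
        ((continuous_eval_const (projIcc 0 T hT.le t)).comp
          continuous_snd).tendsto p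
      have hu : Tendsto (fun q : ℝ × C(Icc (0 : ℝ) T, ℝ) =>
          meanZeroPrimitive T (IccExtend hT.le q.2) t) (𝓝 p)
          (𝓝 (meanZeroPrimitive T (IccExtend hT.le p.2) t)) := by
        rw [tendsto_iff_dist_tendsto_zero]
        refine squeeze_zero (g := fun q => 2 * T * ‖q.2 - p.2‖) (fun _ => dist_nonneg)
          (fun q => ?_) ?_
        · rw [Real.dist_eq, meanZeroPrimitive_sub T (continuous_IccExtend_coe hT _)
            (continuous_IccExtend_coe hT _)]
          exact abs_meanZeroPrimitive_le hT (fun s => (q.2 - p.2).norm_coe_le_norm _) htm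
        · have : Continuous fun q : ℝ × C(Icc (0 : ℝ) T, ℝ) => 2 * T * ‖q.2 - p.2‖ := by fun_prop
          simpa using this.tendsto p
      have hs : Tendsto (fun q : ℝ × C(Icc (0 : ℝ) T, ℝ) => q.1) (𝓝 p) (𝓝 p.1) :=
        continuous_fst.tendsto p
      have hN : Tendsto (fun q => superposition hT F q t) (𝓝 p) (𝓝 (superposition hT F p t)) :=
        (hcont.tendsto (p.1 + meanZeroPrimitive T (IccExtend hT.le p.2) t,
          IccExtend hT.le p.2 t)).comp ((hs.add hu).prodMk_nhds hv)
      simpa using (hN.sub_const (superposition hT F p t)).abs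
  simpa using hlim

/-- The operator sending `(s, v)` to the primitive of the centered superposition is completely
continuous. -/
theorem exists_centeredPrimitive_superposition {T : ℝ} (hT : 0 < T) {F : ℝ → ℝ → ℝ → ℝ}
    (hF : CaratheodoryF T F) :
    ∃ J : ℝ × C(Icc (0 : ℝ) T, ℝ) → C(Icc (0 : ℝ) T, ℝ), Continuous J ∧
      (∀ p t, J p t = centeredPrimitive T (superposition hT F p) t) ∧
      ∀ R, ∃ K : Set C(Icc (0 : ℝ) T, ℝ), IsCompact K ∧ ∀ p, |p.1| ≤ R → ‖p.2‖ ≤ R → J p ∈ K := by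
  have h_int := integrableOn_superposition hT hF
  let J : ℝ × C(Icc (0 : ℝ) T, ℝ) → C(Icc (0 : ℝ) T, ℝ) := fun p =>
    ⟨fun t => centeredPrimitive T (superposition hT F p) t,
      (continuousOn_primitive_of_integrableOn_Icc hT (integrableOn_sub_mean (h_int p))).domRestrict⟩
  refine ⟨J, ?_, fun _ _ => rfl, fun R => ?_⟩
  · refine continuous_iff_continuousAt.2 fun p => ?_
    rw [ContinuousAt, tendsto_iff_dist_tendsto_zero]
    have hlim := (tendsto_integral_abs_superposition_sub hT hF p).const_mul 2
    rw [mul_zero] at hlim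
    refine squeeze_zero (fun _ => dist_nonneg) (fun q => ?_) hlim
    refine (ContinuousMap.dist_le (mul_nonneg zero_le_two
      (integral_nonneg fun _ => abs_nonneg _))).2 fun t => ?_
    exact abs_centeredPrimitive_sub_le hT (h_int q) (h_int p) t.2
  · obtain ⟨γ, hγ, hle⟩ := exists_superposition_bound hT hF R
    have hγm : IntegrableOn (fun τ => γ τ + (1 / T) * ∫ ξ in Icc (0 : ℝ) T, γ ξ)
        (Icc (0 : ℝ) T) := hγ.add (integrableOn_const (by simp))
    refine ⟨_, isCompact_setOf_dist_le (⟨0, le_rfl, hT.le⟩ : Icc (0 : ℝ) T)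
      (continuousOn_primitive_of_integrableOn_Icc hT hγm).domRestrict, fun p hs hv => ⟨?_, ?_⟩⟩
    · exact intervalIntegral.integral_same
    · exact fun t t' => abs_centeredPrimitive_increment_le hT (h_int p) hγ (hle p hs hv) t.2 t'.2

end Nemytskii

section Solutions

theorem starSol_of_fixedPoint {T : ℝ} (hT : 0 < T) {φ : ℝ → ℝ} (hφ : Function.Injective φ)
    {F : ℝ → ℝ → ℝ → ℝ} (hF : CaratheodoryF T F) {l : ℝ} {p : ℝ × C(Icc (0 : ℝ) T, ℝ)}
    (hmean : (∫ t in (0 : ℝ)..T, IccExtend hT.le p.2 t) = 0)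
    (heq : ∃ c, ∀ t : Icc (0 : ℝ) T,
      φ (p.2 t) = c + l * centeredPrimitive T (superposition hT F p) t) :
    StarSol T φ F p.1 l (meanZeroPrimitive T (IccExtend hT.le p.2)) (IccExtend hT.le p.2) := by
  obtain ⟨c, hc⟩ := heq
  have h0 : (0 : ℝ) ∈ Icc (0 : ℝ) T := ⟨le_rfl, hT.le⟩
  have h1 : T ∈ Icc (0 : ℝ) T := ⟨hT.le, le_rfl⟩
  have hv := continuous_IccExtend_coe hT p.2
  have h_int := integrableOn_superposition hT hF p
  have hφt : ∀ t ∈ Icc (0 : ℝ) T, φ (IccExtend hT.le p.2 t) =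
      c + l * centeredPrimitive T (superposition hT F p) t := fun t ht => by
    rw [IccExtend_of_mem hT.le _ ht]
    exact hc ⟨t, ht⟩
  have hφ0 : φ (IccExtend hT.le p.2 0) = c := by
    rw [hφt 0 h0, centeredPrimitive, intervalIntegral.integral_same, mul_zero, add_zero]
  refine ⟨⟨fun t _ => (hasDerivAt_meanZeroPrimitive T hv t).hasDerivWithinAt, hv.continuousOn,
    ?_, ?_⟩, setIntegral_meanZeroPrimitive hT hv, fun t => l * (superposition hT F p t -
      (1 / T) * ∫ ξ in Icc (0 : ℝ) T, superposition hT F p ξ),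
    (integrableOn_sub_mean h_int).const_mul l, fun t ht => ?_, Eventually.of_forall fun _ => rfl⟩
  · simp only [meanZeroPrimitive]
    rw [hmean, intervalIntegral.integral_same]
  · refine hφ ?_
    rw [hφ0, hφt T h1, centeredPrimitive_right hT h_int, mul_zero, add_zero]
  · rw [hφ0, hφt t ht, intervalIntegral.integral_const_mul, centeredPrimitive]

theorem norm_le_of_abs_add_abs_le {T : ℝ} (hT : 0 < T) {v : C(Icc (0 : ℝ) T, ℝ)} {u : ℝ → ℝ}
    {B : ℝ} (hB : ∀ t ∈ Icc (0 : ℝ) T, |u t| + |IccExtend hT.le v t| ≤ B) : ‖v‖ ≤ B := by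
  have hB' : ∀ t : Icc (0 : ℝ) T, ‖v t‖ ≤ B := fun t => by
    have := hB t t.2
    rw [IccExtend_val] at this
    rw [Real.norm_eq_abs]
    linarith [abs_nonneg (u t)]
  exact (ContinuousMap.norm_le _ ((norm_nonneg _).trans (hB' ⟨0, le_rfl, hT.le⟩))).2 hB'

theorem exists_continuous_meanZeroPrimitive_operator {T : ℝ} (hT : 0 < T) :
    ∃ V : C(Icc (0 : ℝ) T, ℝ) → C(Icc (0 : ℝ) T, ℝ), Continuous V ∧
      ∀ v t, V v t = meanZeroPrimitive T (IccExtend hT.le v) t := by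
  refine ⟨fun v => ⟨fun t => meanZeroPrimitive T (IccExtend hT.le v) t,
    (continuous_meanZeroPrimitive T (continuous_IccExtend_coe hT v)).comp
      continuous_subtype_val⟩, ?_, fun _ _ => rfl⟩
  refine (LipschitzWith.of_dist_le_mul (K := ⟨2 * T, by positivity⟩) fun v w => ?_).continuous
  refine (ContinuousMap.dist_le (mul_nonneg NNReal.zero_le_coe dist_nonneg)).2 fun t => ?_
  rw [dist_eq_norm v w]
  change |meanZeroPrimitive T (IccExtend hT.le v) t - meanZeroPrimitive T (IccExtend hT.le w) t| ≤
    2 * T * ‖v - w‖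
  rw [meanZeroPrimitive_sub T (continuous_IccExtend_coe hT _) (continuous_IccExtend_coe hT _)]
  exact abs_meanZeroPrimitive_le hT (fun s => (v - w).norm_coe_le_norm _) t.2

end Solutions

/-- Continuum of solution pairs of Amann–Ambrosetti–Mancini type: under the two a priori
bound assumptions there is a closed connected set `𝒞 ⊆ ℝ × C¹_T` of solution pairs
`(ū, ũ)` of `(★)_{ū,1}` whose projection onto `ℝ` is all of `ℝ`.  A pair `(ũ, ũ')` is
represented by a pair of continuous maps on `[0,T]` (giving `C¹_T` its `C¹` topology). -/
theorem statement11
    (T : ℝ) (hT : 0 < T)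
    (φ : ℝ → ℝ)
    (hφmono : StrictMono φ) (hφcont : Continuous φ)
    (hφsurj : Function.Surjective φ) (hφ0 : φ 0 = 0)
    (F : ℝ → ℝ → ℝ → ℝ) (hF : CaratheodoryF T F)
    (hbd0 : ∃ ub₀ B : ℝ, ∀ lam ∈ Icc (0:ℝ) 1, ∀ ut ut' : ℝ → ℝ,
      StarSol T φ F ub₀ lam ut ut' → ∀ t ∈ Icc (0:ℝ) T, |ut t| + |ut' t| ≤ B)
    (hbd1 : ∀ M : ℝ, 0 < M → ∃ M' : ℝ, 0 < M' ∧ ∀ ub : ℝ, ∀ ut ut' : ℝ → ℝ,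
      StarSol T φ F ub 1 ut ut' → |ub| ≤ M →
      ∀ t ∈ Icc (0:ℝ) T, |ut t| + |ut' t| ≤ M') :
    ∃ 𝒞 : Set (ℝ × (C(Icc (0:ℝ) T, ℝ) × C(Icc (0:ℝ) T, ℝ))),
      IsClosed 𝒞 ∧ IsConnected 𝒞 ∧
      (∀ p ∈ 𝒞, ∃ ut ut' : ℝ → ℝ, StarSol T φ F p.1 1 ut ut' ∧
        ∀ t : Icc (0:ℝ) T, p.2.1 t = ut ↑t ∧ p.2.2 t = ut' ↑t) ∧
      ∀ r : ℝ, ∃ p ∈ 𝒞, p.1 = r := by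
  obtain ⟨A, hAc, hA0, hA⟩ := exists_continuous_zero_mean_inverse hT hφmono hφsurj hφ0
  obtain ⟨J, hJc, hJ, hJcpt⟩ := exists_centeredPrimitive_superposition hT hF
  obtain ⟨V, hVc, hV⟩ := exists_continuous_meanZeroPrimitive_operator hT
  obtain ⟨s₀, B, hB⟩ := hbd0
  let Ψ : ℝ × ℝ × C(Icc (0:ℝ) T, ℝ) → C(Icc (0:ℝ) T, ℝ) := fun q => A (q.1 • J q.2)
  have hsol : ∀ l s v, Ψ (l, s, v) = v →
      StarSol T φ F s l (meanZeroPrimitive T (IccExtend hT.le v)) (IccExtend hT.le v) := by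
    intro l s v hfix
    obtain ⟨hmean, c, hc⟩ := hA (l • J (s, v))
    have hfix' : A (l • J (s, v)) = v := hfix
    rw [hfix'] at hmean hc
    refine starSol_of_fixedPoint hT hφmono.injective hF (p := (s, v)) hmean ⟨c, fun t => ?_⟩
    rw [← hJ]
    exact hc t
  obtain ⟨Z, hZclosed, hZconn, hZfix, hZproj⟩ := exists_connected_fixedPoints (Ψ := Ψ) (s₀ := s₀)
    (hAc.comp (continuous_fst.smul (hJc.comp continuous_snd)))
    (fun R => by
      obtain ⟨K, hK, hJK⟩ := hJcpt R
      refine ⟨A '' ((fun q : ℝ × C(Icc (0:ℝ) T, ℝ) => q.1 • q.2) '' (Icc 0 1 ×ˢ K)),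
        ((isCompact_Icc.prod hK).image continuous_smul).image hAc, fun l hl s v hs hv => ?_⟩
      exact ⟨_, ⟨(l, J (s, v)), ⟨hl, hJK (s, v) hs hv⟩, rfl⟩, rfl⟩)
    (fun v => by simp only [Ψ, zero_smul, hA0])
    ⟨B, fun l hl v hfix => norm_le_of_abs_add_abs_le hT (hB l hl _ _ (hsol l s₀ v hfix))⟩
    (fun M => by
      obtain ⟨M', -, hM'⟩ := hbd1 (|M| + 1) (by positivity)
      refine ⟨M', fun s v hs hfix => norm_le_of_abs_add_abs_le hT
        (hM' s _ _ (hsol 1 s v hfix) ?_)⟩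
      linarith [le_abs_self M])
  refine ⟨(fun q : ℝ × C(Icc (0:ℝ) T, ℝ) => (q.1, (V q.2, q.2))) '' Z, ?_,
    hZconn.image _ (by fun_prop), ?_, fun r => ?_⟩
  · have himg : (fun q : ℝ × C(Icc (0:ℝ) T, ℝ) => (q.1, (V q.2, q.2))) '' Z =
        {x : ℝ × (C(Icc (0:ℝ) T, ℝ) × C(Icc (0:ℝ) T, ℝ)) | (x.1, x.2.2) ∈ Z} ∩
          {x | x.2.1 = V x.2.2} := by
      ext ⟨s, u, v⟩
      constructor
      · rintro ⟨q, hq, hqe⟩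
        obtain ⟨rfl, rfl, rfl⟩ : q.1 = s ∧ V q.2 = u ∧ q.2 = v := by simpa using hqe
        exact ⟨hq, rfl⟩
      · rintro ⟨hmem, hu⟩
        have hu' : u = V v := hu
        exact ⟨(s, v), hmem, by rw [hu']⟩
    rw [himg]
    exact (hZclosed.preimage (by fun_prop)).inter (isClosed_eq (by fun_prop) (by fun_prop))
  · rintro _ ⟨q, hq, rfl⟩
    exact ⟨_, _, hsol 1 q.1 q.2 (hZfix q hq), fun t => ⟨hV q.2 t, (IccExtend_val hT.le _ t).symm⟩⟩
  · obtain ⟨q, hq, hqr⟩ := hZproj r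
    exact ⟨_, ⟨q, hq, rfl⟩, hqr⟩
end
end

section
/- Let g : [0,T]×ℝ → ℝ be a Carathéodory function and assume there exists ρ ∈ L¹([0,T],[0,+∞)) such that |g(t,u)| ≤ ρ(t) for a.e. t ∈ [0,T] and all u ∈ ℝ. For ū ∈ ℝ and λ ∈ [0,1], consider the problem: find ũ ∈ 𝔇 with ∫₀ᵀ ũ(t) dt = 0 such that (φ(ũ'))'(t) + f(ū + ũ(t))ũ'(t) + λ g(t, ū + ũ(t)) − (λ/T)∫₀ᵀ g(ξ, ū + ũ(ξ)) dξ = 0 for a.e. t ∈ [0,T]. Then: (i) there exists K > 0, depending only on φ and ρ, such that every solution pair (ū,ũ) of this problem with λ ∈ [0,1] satisfies ∫₀ᵀ |ũ'(t)| dt ≤ K and ‖ũ‖_∞ ≤ K; (ii) for every M > 0 there exists M' > 0, depending only on φ, f, ρ and M, such that every solution pair (ū,ũ) with λ = 1 and |ū| ≤ M satisfies ‖ũ‖_∞ + ‖ũ'‖_∞ ≤ M'. -/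
open MeasureTheory Set Filter

noncomputable section

/-- `h : [0,T] × ℝ → ℝ` is a Carathéodory function: measurable in `t`, continuous in `u`
for a.e. `t`, and locally `L¹`-dominated. -/
def Caratheodory (T : ℝ) (h : ℝ → ℝ → ℝ) : Prop :=
  (∀ u : ℝ, Measurable fun t => h t u) ∧
    (∀ᵐ t ∂(muT T), Continuous fun u => h t u) ∧
    ∀ r : ℝ, 0 < r → ∃ γ : ℝ → ℝ, IntegrableOn γ (Icc (0:ℝ) T) ∧
      ∀ᵐ t ∂(muT T), ∀ u : ℝ, |u| ≤ r → |h t u| ≤ γ t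

/-- `(ũ, ũ')` solves the auxiliary problem: `ũ ∈ 𝔇` has zero mean and
`(φ(ũ'))' + f(ū+ũ)ũ' + λ g(t, ū+ũ) − (λ/T)∫₀ᵀ g(ξ, ū+ũ(ξ)) dξ = 0` a.e. on `[0,T]`. -/
def AAMSol (T : ℝ) (φ f : ℝ → ℝ) (g : ℝ → ℝ → ℝ) (ub lam : ℝ)
    (ut ut' : ℝ → ℝ) : Prop :=
  IsC1Periodic T ut ut' ∧ (∫ t in Icc (0:ℝ) T, ut t) = 0 ∧
    ∃ w : ℝ → ℝ, IntegrableOn w (Icc (0:ℝ) T) ∧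
      (∀ t ∈ Icc (0:ℝ) T, φ (ut' t) = φ (ut' 0) + ∫ τ in (0:ℝ)..t, w τ) ∧
      ∀ᵐ t ∂(muT T), w t + f (ub + ut t) * ut' t + lam * g t (ub + ut t) -
        (lam / T) * (∫ ξ in Icc (0:ℝ) T, g ξ (ub + ut ξ)) = 0

/-- Integration by parts for indefinite integrals of interval integrable functions. -/
theorem integral_mul_eq_sub_of_indefinite_integral {a b : ℝ} (hab : a ≤ b) {u v U W : ℝ → ℝ}
    (hv : IntervalIntegrable v volume a b) (hW : IntervalIntegrable W volume a b)
    (hu : ∀ t ∈ Icc a b, u t = u a + ∫ τ in a..t, v τ)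
    (hU : ∀ t ∈ Icc a b, U t = U a + ∫ τ in a..t, W τ) :
    ∫ t in a..b, u t * W t = u b * U b - u a * U a - ∫ t in a..b, v t * U t := by
  have ac : ∀ (c : ℝ) {h : ℝ → ℝ}, IntervalIntegrable h volume a b →
      AbsolutelyContinuousOnInterval (fun t => c + ∫ τ in a..t, h τ) a b := fun c h hh =>
    (LipschitzWith.const c).lipschitzOnWith.absolutelyContinuousOnInterval.fun_add
      (hh.absolutelyContinuousOnInterval_intervalIntegral left_mem_uIcc)
  have dv : ∀ (c : ℝ) {h : ℝ → ℝ}, IntervalIntegrable h volume a b →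
      ∀ᵐ t, t ∈ uIcc a b → deriv (fun t => c + ∫ τ in a..t, h τ) t = h t := fun c h hh => by
    filter_upwards [hh.ae_hasDerivAt_integral] with t ht hm
    exact ((ht hm a left_mem_uIcc).const_add c).deriv
  have key := (ac (u a) hv).integral_mul_deriv_eq_deriv_mul (ac (U a) hW)
  rw [← hu b (right_mem_Icc.2 hab), ← hU b (right_mem_Icc.2 hab)] at key
  simp only [intervalIntegral.integral_same, add_zero] at key
  have e1 : ∫ t in a..b, u t * W t = ∫ t in a..b, (u a + ∫ τ in a..t, v τ) *
      deriv (fun t => U a + ∫ τ in a..t, W τ) t := by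
    refine intervalIntegral.integral_congr_ae ?_
    filter_upwards [dv (U a) hW] with t ht hm
    rw [ht (uIoc_subset_uIcc hm), hu t (uIcc_of_le hab ▸ uIoc_subset_uIcc hm)]
  have e2 : ∫ t in a..b, v t * U t = ∫ t in a..b,
      deriv (fun t => u a + ∫ τ in a..t, v τ) t * (U a + ∫ τ in a..t, W τ) := by
    refine intervalIntegral.integral_congr_ae ?_
    filter_upwards [dv (u a) hv] with t ht hm
    rw [ht (uIoc_subset_uIcc hm), hU t (uIcc_of_le hab ▸ uIoc_subset_uIcc hm)]
  rw [e1, e2, key]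

/-- The fundamental theorem of calculus for `C¹` functions on `[0,T]`. -/
theorem IsC1Periodic.integral_eq_sub {T : ℝ} {u u' : ℝ → ℝ} (h : IsC1Periodic T u u')
    {s t : ℝ} (hs : s ∈ Icc 0 T) (ht : t ∈ Icc 0 T) : ∫ τ in s..t, u' τ = u t - u s := by
  wlog hst : s ≤ t generalizing s t
  · rw [intervalIntegral.integral_symm, this ht hs (le_of_not_ge hst), neg_sub]
  have hsub : Icc s t ⊆ Icc 0 T := Icc_subset_Icc hs.1 ht.2
  refine intervalIntegral.integral_eq_sub_of_hasDerivAt_of_le hst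
    (fun x hx => ((h.1 x (hsub hx)).continuousWithinAt).mono hsub) (fun x hx => ?_)
    ((h.2.1.mono hsub).intervalIntegrable_of_Icc hst)
  exact (h.1 x (hsub (Ioo_subset_Icc_self hx))).hasDerivAt
    (Icc_mem_nhds (hs.1.trans_lt hx.1) (hx.2.trans_le ht.2))

theorem IsC1Periodic.continuousOn {T : ℝ} {u u' : ℝ → ℝ} (h : IsC1Periodic T u u') :
    ContinuousOn u (Icc 0 T) := fun t ht => (h.1 t ht).continuousWithinAt

/-- Integrals over subintervals of `[0,T]` are bounded by the `L¹` norm. -/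
theorem abs_intervalIntegral_le_integral_abs {T : ℝ} {v : ℝ → ℝ}
    (hv : IntegrableOn v (Icc 0 T)) {s t : ℝ} (hs : s ∈ Icc 0 T) (ht : t ∈ Icc 0 T) :
    |∫ τ in s..t, v τ| ≤ ∫ τ in Icc 0 T, |v τ| := by
  refine (intervalIntegral.norm_integral_le_integral_norm_uIoc (f := v)).trans ?_
  refine setIntegral_mono_set hv.norm (Eventually.of_forall fun τ => abs_nonneg _) ?_
  exact (uIoc_subset_uIcc.trans (uIcc_subset_Icc hs ht)).eventuallyLE

/-- A zero mean `C¹` function is bounded by the `L¹` norm of its derivative. -/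
theorem IsC1Periodic.abs_le_integral_abs_deriv {T : ℝ} (hT : 0 < T) {u u' : ℝ → ℝ}
    (h : IsC1Periodic T u u') (h0 : ∫ t in Icc 0 T, u t = 0) {t : ℝ} (ht : t ∈ Icc 0 T) :
    |u t| ≤ ∫ τ in Icc 0 T, |u' τ| := by
  set L := ∫ τ in Icc 0 T, |u' τ|
  have hui : IntegrableOn u (Icc 0 T) := h.continuousOn.integrableOn_Icc
  have hb : ‖∫ s in Icc 0 T, (u t - u s)‖ ≤ L * volume.real (Icc 0 T) := by
    refine norm_setIntegral_le_of_norm_le_const measure_Icc_lt_top fun s hs => ?_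
    rw [← h.integral_eq_sub hs ht]
    exact abs_intervalIntegral_le_integral_abs h.2.1.integrableOn_Icc hs ht
  have hci : IntegrableOn (fun _ : ℝ => u t) (Icc 0 T) := integrableOn_const (by simp)
  rw [integral_sub hci hui, h0, setIntegral_const, sub_zero,
    Real.volume_real_Icc_of_le hT.le, sub_zero, smul_eq_mul, norm_mul, Real.norm_eq_abs,
    Real.norm_eq_abs, abs_of_pos hT, mul_comm] at hb
  exact le_of_mul_le_mul_right hb hT

/-- The mean of a function dominated by `ρ`, scaled by `lam ∈ [0,1]`. -/
theorem abs_scaled_mean_le {T lam : ℝ} (hT : 0 < T) (hlam : lam ∈ Icc (0 : ℝ) 1) {ρ h : ℝ → ℝ}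
    (hρ : IntegrableOn ρ (Icc 0 T)) (hh : ∀ᵐ t ∂(muT T), |h t| ≤ ρ t) :
    |lam / T * ∫ t in Icc 0 T, h t| ≤ (∫ t in Icc 0 T, ρ t) / T := by
  have hb : ‖∫ t in Icc 0 T, h t‖ ≤ ∫ t in Icc 0 T, ρ t := norm_integral_le_of_norm_le hρ hh
  rw [abs_mul, abs_of_nonneg (div_nonneg hlam.1 hT.le), div_mul_eq_mul_div]
  have := mul_le_of_le_one_left (abs_nonneg (∫ t in Icc 0 T, h t)) hlam.2
  gcongr
  exact this.trans hb

/-- The energy estimate obtained by testing the equation against the solution. -/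
theorem AAMSol.integral_phi_mul_le {T : ℝ} (hT : 0 < T) {φ f ρ : ℝ → ℝ} {g : ℝ → ℝ → ℝ}
    (hf : Continuous f) (hρ : IntegrableOn ρ (Icc 0 T))
    (hg : ∀ᵐ t ∂(muT T), ∀ u : ℝ, |g t u| ≤ ρ t) {lam ub : ℝ} (hlam : lam ∈ Icc (0 : ℝ) 1)
    {u u' : ℝ → ℝ} (h : AAMSol T φ f g ub lam u u') :
    ∫ t in Icc 0 T, φ (u' t) * u' t ≤ (∫ t in Icc 0 T, ρ t) * ∫ t in Icc 0 T, |u' t| := by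
  obtain ⟨hC, h0, w, hw, hφw, heq⟩ := h
  set L := ∫ t in Icc 0 T, |u' t|
  set c := lam / T * ∫ ξ in Icc 0 T, g ξ (ub + u ξ)
  have hu := hC.continuousOn
  have hicc : ∀ v : ℝ → ℝ, ∫ t in Icc 0 T, v t = ∫ t in (0 : ℝ)..T, v t := fun v => by
    rw [intervalIntegral.integral_of_le hT.le, integral_Icc_eq_integral_Ioc]
  have hparts : ∫ t in Icc 0 T, u t * w t = - ∫ t in Icc 0 T, φ (u' t) * u' t := by
    rw [hicc, hicc]
    have := integral_mul_eq_sub_of_indefinite_integral hT.le (u := u) (v := u')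
      (U := fun t => φ (u' t)) (W := w) (hC.2.1.intervalIntegrable_of_Icc hT.le)
      ((intervalIntegrable_iff_integrableOn_Icc_of_le hT.le).2 hw)
      (fun t ht => by rw [hC.integral_eq_sub (left_mem_Icc.2 hT.le) ht]; ring) hφw
    rw [this, hC.2.2.1, hC.2.2.2]
    simp only [mul_comm, sub_self, zero_sub]
  have hexact : ∫ t in Icc 0 T, f (ub + u t) * u t * u' t = 0 := by
    rw [hicc]
    have hsub := intervalIntegral.integral_comp_mul_deriv'' (a := 0) (b := T) (f := u) (f' := u')
      (g := fun x => f (ub + x) * x) (by rwa [uIcc_of_le hT.le])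
      (fun x hx => by
        rw [min_eq_left hT.le, max_eq_right hT.le] at hx
        exact ((hC.1 x (Ioo_subset_Icc_self hx)).hasDerivAt
          (Icc_mem_nhds hx.1 hx.2)).hasDerivWithinAt)
      (by rw [uIcc_of_le hT.le]; exact hC.2.1)
      (Continuous.continuousOn (by fun_prop))
    rw [hC.2.2.1, intervalIntegral.integral_same] at hsub
    exact hsub
  have i1 : IntegrableOn (fun t => u t * w t) (Icc 0 T) := hw.continuousOn_mul hu isCompact_Icc
  have i2 : IntegrableOn (fun t => f (ub + u t) * u t * u' t) (Icc 0 T) :=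
    (((hf.comp_continuousOn (continuousOn_const.add hu)).mul hu).mul hC.2.1).integrableOn_Icc
  have i3 : IntegrableOn (fun t => c * u t) (Icc 0 T) := hu.integrableOn_Icc.const_mul c
  have i12 : IntegrableOn (fun t => u t * w t + f (ub + u t) * u t * u' t) (Icc 0 T) := i1.add i2
  have htest : ∫ t in Icc 0 T, (u t * w t + f (ub + u t) * u t * u' t - c * u t) =
      - ∫ t in Icc 0 T, φ (u' t) * u' t := by
    rw [integral_sub i12 i3, integral_add i1 i2, hparts, hexact,
      integral_const_mul, h0]
    ring
  have hbd : ‖∫ t in Icc 0 T, (u t * w t + f (ub + u t) * u t * u' t - c * u t)‖ ≤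
      ∫ t in Icc 0 T, ρ t * L := by
    refine norm_integral_le_of_norm_le (hρ.mul_const L) ?_
    filter_upwards [hg, heq, ae_restrict_mem measurableSet_Icc] with t hgt het htm
    have e : u t * w t + f (ub + u t) * u t * u' t - c * u t =
        -(lam * g t (ub + u t) * u t) := by
      linear_combination u t * het
    rw [e, norm_neg, Real.norm_eq_abs, abs_mul, abs_mul, abs_of_nonneg hlam.1]
    have hg1 : lam * |g t (ub + u t)| ≤ ρ t :=
      (mul_le_of_le_one_left (abs_nonneg _) hlam.2).trans (hgt _)
    exact mul_le_mul hg1 (hC.abs_le_integral_abs_deriv hT h0 htm) (abs_nonneg _)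
      ((abs_nonneg _).trans (hgt 0))
  rw [htest, norm_neg, integral_mul_const] at hbd
  exact (le_abs_self _).trans hbd

/-- Outside a bounded set an increasing surjection exceeds any given bound in modulus. -/
theorem exists_radius_abs_gt {φ : ℝ → ℝ} (hmono : StrictMono φ) (hsurj : Function.Surjective φ)
    (A : ℝ) : ∃ R : ℝ, 0 ≤ R ∧ ∀ s, R < s → A < φ s ∧ φ (-s) < -A := by
  obtain ⟨p, hp⟩ := hsurj A
  obtain ⟨q, hq⟩ := hsurj (-A)
  refine ⟨max |p| |q|, (abs_nonneg p).trans (le_max_left _ _), fun s hs => ⟨?_, ?_⟩⟩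
  · rw [← hp]
    exact hmono ((le_abs_self p).trans_lt ((le_max_left _ _).trans_lt hs))
  · rw [← hq]
    exact hmono (by linarith [neg_abs_le q, (le_max_right |p| |q|).trans_lt hs])

/-- For an increasing surjection `φ`, the product `φ s * s` grows faster than any multiple of `|s|`. -/
theorem exists_mul_abs_sub_le_phi_mul {φ : ℝ → ℝ} (hmono : StrictMono φ)
    (hsurj : Function.Surjective φ) (h0 : φ 0 = 0) {A : ℝ} (hA : 0 ≤ A) :
    ∃ B : ℝ, 0 ≤ B ∧ ∀ s, A * |s| - B ≤ φ s * s := by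
  obtain ⟨R, hR, h⟩ := exists_radius_abs_gt hmono hsurj A
  refine ⟨A * R, mul_nonneg hA hR, fun s => ?_⟩
  have hpos : 0 ≤ φ s * s := by
    rcases le_total 0 s with hs | hs
    · exact mul_nonneg (h0 ▸ hmono.monotone hs) hs
    · exact mul_nonneg_of_nonpos_of_nonpos (h0 ▸ hmono.monotone hs) hs
  rcases le_or_gt |s| R with hs | hs
  · nlinarith [mul_le_mul_of_nonneg_left hs hA]
  · rcases le_total 0 s with hs0 | hs0
    · rw [abs_of_nonneg hs0] at hs ⊢
      nlinarith [(h s hs).1, mul_nonneg hA hR]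
    · rw [abs_of_nonpos hs0] at hs ⊢
      have := (h (-s) hs).2
      rw [neg_neg] at this
      nlinarith [mul_nonneg hA hR]

/-- The `L¹` bound for the derivative of solutions, depending only on `φ` and `ρ`. -/
theorem exists_integral_abs_deriv_le {T : ℝ} (hT : 0 < T) {φ ρ : ℝ → ℝ}
    (hmono : StrictMono φ) (hcont : Continuous φ) (hsurj : Function.Surjective φ) (h0 : φ 0 = 0)
    (hρ : IntegrableOn ρ (Icc 0 T)) (hρpos : ∀ᵐ t ∂(muT T), 0 ≤ ρ t) :
    ∃ K : ℝ, 0 < K ∧ ∀ f : ℝ → ℝ, Continuous f → ∀ g : ℝ → ℝ → ℝ,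
      (∀ᵐ t ∂(muT T), ∀ u : ℝ, |g t u| ≤ ρ t) → ∀ lam ∈ Icc (0 : ℝ) 1, ∀ ub : ℝ,
      ∀ u u' : ℝ → ℝ, AAMSol T φ f g ub lam u u' → ∫ t in Icc 0 T, |u' t| ≤ K := by
  have hN : 0 ≤ ∫ t in Icc 0 T, ρ t := integral_nonneg_of_ae hρpos
  obtain ⟨B, hB, hlow⟩ := exists_mul_abs_sub_le_phi_mul hmono hsurj h0
    (A := (∫ t in Icc 0 T, ρ t) + 1) (by positivity)
  refine ⟨B * T + 1, by positivity, fun f hf g hg lam hlam ub u u' h => ?_⟩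
  have hen := h.integral_phi_mul_le hT hf hρ hg hlam
  have hu' : ContinuousOn u' (Icc 0 T) := h.1.2.1
  have i1 : IntegrableOn (fun t => ((∫ t in Icc 0 T, ρ t) + 1) * |u' t|) (Icc 0 T) :=
    (continuousOn_const.mul hu'.abs).integrableOn_Icc
  have i2 : IntegrableOn (fun _ : ℝ => B) (Icc 0 T) := integrableOn_const (by simp)
  have i3 : IntegrableOn (fun t => φ (u' t) * u' t) (Icc 0 T) :=
    ((hcont.comp_continuousOn hu').mul hu').integrableOn_Icc
  have hint : ∫ t in Icc 0 T, (((∫ t in Icc 0 T, ρ t) + 1) * |u' t| - B) ≤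
      ∫ t in Icc 0 T, φ (u' t) * u' t := integral_mono (i1.sub i2) i3 fun t => hlow (u' t)
  rw [integral_sub i1 i2, integral_const_mul, setIntegral_const,
    Real.volume_real_Icc_of_le hT.le, sub_zero, smul_eq_mul] at hint
  linarith

/-- The derivative of a `C¹` function with equal end values vanishes somewhere. -/
theorem IsC1Periodic.exists_deriv_eq_zero {T : ℝ} (hT : 0 < T) {u u' : ℝ → ℝ}
    (h : IsC1Periodic T u u') : ∃ s ∈ Icc 0 T, u' s = 0 := by
  obtain ⟨s, hs, hs0⟩ := exists_hasDerivAt_eq_zero hT h.continuousOn h.2.2.1 fun x hx =>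
    (h.1 x (Ioo_subset_Icc_self hx)).hasDerivAt (Icc_mem_nhds hx.1 hx.2)
  exact ⟨s, Ioo_subset_Icc_self hs, hs0⟩

/-- The bound for `φ ∘ u'` in terms of an `L¹` bound of `u'` and a bound of `f` along `u`. -/
theorem AAMSol.abs_phi_deriv_le {T : ℝ} (hT : 0 < T) {φ f ρ : ℝ → ℝ} {g : ℝ → ℝ → ℝ}
    (h0 : φ 0 = 0) (hρ : IntegrableOn ρ (Icc 0 T))
    (hg : ∀ᵐ t ∂(muT T), ∀ u : ℝ, |g t u| ≤ ρ t) {lam ub : ℝ} (hlam : lam ∈ Icc (0 : ℝ) 1)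
    {u u' : ℝ → ℝ} (h : AAMSol T φ f g ub lam u u') {C : ℝ}
    (hC : ∀ t ∈ Icc 0 T, |f (ub + u t)| ≤ C) {t : ℝ} (ht : t ∈ Icc 0 T) :
    |φ (u' t)| ≤ C * (∫ τ in Icc 0 T, |u' τ|) + 2 * ∫ τ in Icc 0 T, ρ τ := by
  obtain ⟨hC1, -, w, hw, hφw, heq⟩ := h
  set N := ∫ τ in Icc 0 T, ρ τ
  obtain ⟨s, hs, hs0⟩ := hC1.exists_deriv_eq_zero hT
  have hsub : ∀ {r}, r ∈ Icc 0 T → IntervalIntegrable w volume 0 r := fun {r} hr =>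
    (intervalIntegrable_iff_integrableOn_Icc_of_le hr.1).2
      (hw.mono_set (Icc_subset_Icc_right hr.2))
  have hdiff : φ (u' t) = ∫ τ in s..t, w τ := by
    have es := hφw s hs
    rw [hs0, h0] at es
    rw [← intervalIntegral.integral_interval_sub_left (hsub ht) (hsub hs), hφw t ht]
    linarith
  have i1 : IntegrableOn (fun τ => C * |u' τ|) (Icc 0 T) :=
    (continuousOn_const.mul hC1.2.1.abs).integrableOn_Icc
  have i2 : IntegrableOn (fun _ : ℝ => N / T) (Icc 0 T) := integrableOn_const (by simp)
  have i12 : IntegrableOn (fun τ => C * |u' τ| + ρ τ) (Icc 0 T) := i1.add hρ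
  have hle : ∫ τ in Icc 0 T, |w τ| ≤ ∫ τ in Icc 0 T, (C * |u' τ| + ρ τ + N / T) := by
    refine integral_mono_ae hw.abs (i12.add i2) ?_
    have hmean := abs_scaled_mean_le hT hlam hρ (h := fun ξ => g ξ (ub + u ξ))
      (hg.mono fun ξ hξ => hξ _)
    filter_upwards [hg, heq, ae_restrict_mem measurableSet_Icc] with τ hgτ heτ hτ
    have e : w τ = lam / T * (∫ ξ in Icc 0 T, g ξ (ub + u ξ)) - f (ub + u τ) * u' τ -
        lam * g τ (ub + u τ) := by linarith
    have b1 : |f (ub + u τ) * u' τ| ≤ C * |u' τ| := by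
      rw [abs_mul]
      exact mul_le_mul_of_nonneg_right (hC τ hτ) (abs_nonneg _)
    have b2 : |lam * g τ (ub + u τ)| ≤ ρ τ := by
      rw [abs_mul, abs_of_nonneg hlam.1]
      exact (mul_le_of_le_one_left (abs_nonneg _) hlam.2).trans (hgτ _)
    rw [e]
    refine (abs_sub _ _).trans ?_
    linarith [abs_sub (lam / T * (∫ ξ in Icc 0 T, g ξ (ub + u ξ))) (f (ub + u τ) * u' τ)]
  rw [integral_add i12 i2, integral_add i1 hρ, integral_const_mul, setIntegral_const,
    Real.volume_real_Icc_of_le hT.le, sub_zero, smul_eq_mul, mul_div_cancel₀ _ hT.ne'] at hle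
  rw [hdiff]
  linarith [abs_intervalIntegral_le_integral_abs hw hs ht]

/-- A priori bounds for the auxiliary parameter-dependent problem: (i) a bound `K`,
depending only on `φ` and `ρ` (hence uniform in `f`, `g`, `λ`, `ū`), for `∫₀ᵀ|ũ'|` and
`‖ũ‖_∞`; (ii) for every `M > 0`, a `C¹` bound `M'`, depending only on `φ`, `f`, `ρ`, `M`,
for the solutions at `λ = 1` with `|ū| ≤ M`. -/
theorem statement12
    (T : ℝ) (hT : 0 < T)
    (φ : ℝ → ℝ)
    (hφmono : StrictMono φ) (hφcont : Continuous φ)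
    (hφsurj : Function.Surjective φ) (hφ0 : φ 0 = 0)
    (ρ : ℝ → ℝ) (hρint : IntegrableOn ρ (Icc (0:ℝ) T))
    (hρpos : ∀ᵐ t ∂(muT T), 0 ≤ ρ t) :
    (∃ K : ℝ, 0 < K ∧ ∀ f : ℝ → ℝ, Continuous f →
      ∀ g : ℝ → ℝ → ℝ, Caratheodory T g →
      (∀ᵐ t ∂(muT T), ∀ u : ℝ, |g t u| ≤ ρ t) →
      ∀ lam ∈ Icc (0:ℝ) 1, ∀ ub : ℝ, ∀ ut ut' : ℝ → ℝ,
        AAMSol T φ f g ub lam ut ut' →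
        (∫ t in Icc (0:ℝ) T, |ut' t|) ≤ K ∧ ∀ t ∈ Icc (0:ℝ) T, |ut t| ≤ K) ∧
    ∀ f : ℝ → ℝ, Continuous f → ∀ M : ℝ, 0 < M → ∃ M' : ℝ, 0 < M' ∧
      ∀ g : ℝ → ℝ → ℝ, Caratheodory T g →
      (∀ᵐ t ∂(muT T), ∀ u : ℝ, |g t u| ≤ ρ t) →
      ∀ ub : ℝ, ∀ ut ut' : ℝ → ℝ, AAMSol T φ f g ub 1 ut ut' → |ub| ≤ M →
        ∀ t ∈ Icc (0:ℝ) T, |ut t| + |ut' t| ≤ M' := by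
  obtain ⟨K, hK, hKb⟩ := exists_integral_abs_deriv_le hT hφmono hφcont hφsurj hφ0 hρint hρpos
  refine ⟨⟨K, hK, fun f hf g _ hg lam hlam ub ut ut' h => ?_⟩, fun f hf M hM => ?_⟩
  · have hL := hKb f hf g hg lam hlam ub ut ut' h
    exact ⟨hL, fun t ht => (h.1.abs_le_integral_abs_deriv hT h.2.1 ht).trans hL⟩
  obtain ⟨C, hC⟩ := (isCompact_Icc (a := -(M + K)) (b := M + K)).exists_bound_of_continuousOn
    hf.continuousOn
  have hC0 : 0 ≤ C := (norm_nonneg _).trans (hC 0 ⟨by linarith, by linarith⟩)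
  obtain ⟨R, hR, hRb⟩ := exists_radius_abs_gt hφmono hφsurj
    (C * K + 2 * ∫ τ in Icc 0 T, ρ τ)
  refine ⟨K + R, by linarith, fun g _ hg ub ut ut' h hub t ht => ?_⟩
  have hL := hKb f hf g hg 1 (by simp) ub ut ut' h
  have hu : ∀ s ∈ Icc 0 T, |ut s| ≤ K := fun s hs =>
    (h.1.abs_le_integral_abs_deriv hT h.2.1 hs).trans hL
  have hφb := h.abs_phi_deriv_le hT hφ0 hρint hg (by simp) (C := C)
    (fun s hs => hC _ (abs_le.1 ((abs_add_le _ _).trans (add_le_add hub (hu s hs))))) ht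
  have hφb' := hφb.trans (add_le_add_left (mul_le_mul_of_nonneg_left hL hC0) _)
  refine add_le_add (hu t ht) (le_of_not_gt fun hlt => ?_)
  have hgt := hRb _ hlt
  rcases abs_cases (ut' t) with ⟨e, -⟩ | ⟨e, -⟩ <;> rw [e] at hgt
  · linarith [hgt.1, le_abs_self (φ (ut' t))]
  · rw [neg_neg] at hgt
    linarith [hgt.2, neg_abs_le (φ (ut' t))]
end
end

section
/- Let g : [0,T]×ℝ → ℝ be a Carathéodory function. Assume there exists ρ ∈ L¹([0,T],[0,+∞)) such that |g(t,u)| ≤ ρ(t) for a.e. t ∈ [0,T] and all u ≥ 0. Then for every d > 0 there exists g₀ ∈ ℝ such that the equation (φ(u'))' + f(u)u' + g(t,u) = g₀ has a T-periodic solution u₀ with u₀(t) ≥ d for all t ∈ [0,T]. Analogously, if |g(t,u)| ≤ ρ(t) for a.e. t ∈ [0,T] and all u ≤ 0, then for every d > 0 there exists g₀ ∈ ℝ such that the same equation has a T-periodic solution u₀ with u₀(t) ≤ −d for all t ∈ [0,T]. -/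
open MeasureTheory Set Filter

noncomputable section

/-- `u` is a `T`-periodic solution of `(φ(u'))' + f(u)u' + g(t,u) = s`. -/
def IsSolEs (T : ℝ) (φ f : ℝ → ℝ) (g : ℝ → ℝ → ℝ) (s : ℝ) (u : ℝ → ℝ) : Prop :=
  ∃ u' w : ℝ → ℝ, IsC1Periodic T u u' ∧ IsACPhiDeriv T φ u' w ∧
    ∀ᵐ t ∂(muT T), w t + f (u t) * u' t + g t (u t) = s

open Topology

/-- A continuous vector field on the plane which on some circle centred at the origin never
points in the direction opposite to the position vector has a zero. -/
theorem Complex.exists_zero_of_ne_neg_smul {G : ℂ → ℂ} (hG : Continuous G) {R : ℝ} (hR : 0 < R)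
    (h : ∀ z : ℂ, ‖z‖ = R → ∀ l : ℝ, 0 ≤ l → G z ≠ -(l * z)) : ∃ z, G z = 0 := by
  by_contra! hne
  obtain ⟨H, ⟨-, hH⟩, -⟩ := Complex.isCoveringMapOn_exp.existsUnique_continuousMap_lifts
    (⟨G, hG⟩ : C(ℂ, ℂ)) (a₀ := 0) (e₀ := Complex.log (G 0)) (by simpa using Complex.exp_log (hne 0))
    (fun a => by simpa using hne a)
  have hH' : ∀ z, Complex.exp (H z) = G z := fun z => congrFun hH z
  set c : ℝ → ℂ := fun θ => R * Complex.exp (θ * Complex.I) with hc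
  have hcc : Continuous c := by fun_prop
  have hcn : ∀ θ, ‖c θ‖ = R := fun θ => by
    simp [hc, Complex.norm_exp_ofReal_mul_I, abs_of_pos hR]
  have hc0 : ∀ θ, c θ ≠ 0 := fun θ h0 => by
    have := hcn θ
    rw [h0, norm_zero] at this
    exact hR.ne this
  have hslit : ∀ θ, G (c θ) / c θ ∈ Complex.slitPlane := by
    intro θ
    by_contra hs
    rw [Complex.mem_slitPlane_iff_not_le_zero, not_not, Complex.le_def] at hs
    obtain ⟨hre, him⟩ := hs
    refine h (c θ) (hcn θ) (-(G (c θ) / c θ).re) (by simpa using hre) ?_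
    have : ((-(G (c θ) / c θ).re : ℝ) : ℂ) = -(G (c θ) / c θ) := by
      apply Complex.ext <;> simp_all
    rw [this, neg_mul, neg_neg, div_mul_cancel₀ _ (hc0 θ)]
  set k : ℝ → ℂ := fun θ => H (c θ) - Complex.log (G (c θ) / c θ) - θ * Complex.I - Real.log R
    with hk
  have hkc : Continuous k := by
    have : Continuous fun θ => Complex.log (G (c θ) / c θ) :=
      ((hG.comp hcc).div hcc hc0).clog hslit
    have h2 : Continuous fun θ => H (c θ) := H.continuous.comp hcc
    fun_prop
  have hkexp : ∀ θ, Complex.exp (k θ) = 1 := by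
    intro θ
    have hR' : (R : ℂ) ≠ 0 := by exact_mod_cast hR.ne'
    rw [hk]
    simp only
    rw [Complex.exp_sub, Complex.exp_sub, Complex.exp_sub, hH',
      Complex.exp_log (div_ne_zero (hne _) (hc0 θ)), ← Complex.ofReal_exp, Real.exp_log hR,
      div_div_cancel₀ (hne _)]
    simp only [hc]
    field_simp
  choose n hn using fun θ => Complex.exp_eq_one_iff.1 (hkexp θ)
  have hpi : (2 * Real.pi * Complex.I : ℂ) ≠ 0 := Complex.two_pi_I_ne_zero
  have hnc : Continuous n := by
    have h1 : Continuous fun θ => ((n θ : ℝ)) := by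
      have : (fun θ => ((n θ : ℝ))) = fun θ => (k θ / (2 * Real.pi * Complex.I)).re := by
        funext θ
        rw [hn θ, mul_div_cancel_right₀ _ hpi]
        simp
      rw [this]
      exact Complex.continuous_re.comp (hkc.div_const _)
    exact Int.isClosedEmbedding_coe_real.isInducing.continuous_iff.2 h1
  have hconst : n 0 = n (2 * Real.pi) :=
    PreconnectedSpace.constant inferInstance hnc
  have hper : c (2 * Real.pi) = c 0 := by
    simp [hc, Complex.exp_two_pi_mul_I]
  have h0 := hn 0
  have h1 := hn (2 * Real.pi)
  rw [← hconst, ← h0] at h1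
  simp only [hk, hper] at h1
  apply hpi
  push_cast at h1
  linear_combination -h1

/-- Sequential compactness of the functions on the line with a common Lipschitz constant and a
common value at the origin. -/
theorem exists_subseq_tendsto_of_lipschitzWith {K : NNReal} {c : ℝ} {u : ℕ → ℝ → ℝ}
    (hu : ∀ n, LipschitzWith K (u n)) (hu0 : ∀ n, u n 0 = c) :
    ∃ (v : ℝ → ℝ) (k : ℕ → ℕ), Continuous v ∧ StrictMono k ∧
      ∀ t, Tendsto (fun n => u (k n) t) atTop (𝓝 (v t)) := by
  set S : Set C(ℝ, ℝ) := {w | LipschitzWith K w ∧ w 0 = c} with hS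
  have himage : ContinuousMap.toFun '' S =
      (⋂ (x : ℝ) (y : ℝ), {w : ℝ → ℝ | dist (w x) (w y) ≤ K * dist x y}) ∩ {w | w 0 = c} := by
    ext w
    simp only [mem_image, mem_inter_iff, mem_iInter, mem_ofPred_eq, hS]
    constructor
    · rintro ⟨w, ⟨h1, h2⟩, rfl⟩
      exact ⟨fun x y => h1.dist_le_mul x y, h2⟩
    · rintro ⟨h1, h2⟩
      have h3 : LipschitzWith K w := LipschitzWith.of_dist_le_mul h1
      exact ⟨⟨w, h3.continuous⟩, ⟨h3, h2⟩, rfl⟩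
  have hcomp : IsCompact (ContinuousMap.toFun '' S) := by
    refine (isCompact_univ_pi fun t : ℝ => isCompact_closedBall c (K * |t|)).of_isClosed_subset
      ?_ ?_
    · rw [himage]
      refine (isClosed_iInter fun x => isClosed_iInter fun y => ?_).inter ?_
      · exact isClosed_le (by fun_prop) (by fun_prop)
      · exact isClosed_eq (by fun_prop) (by fun_prop)
    · rw [himage]
      rintro w ⟨h1, h2⟩ t -
      simp only [mem_iInter, mem_ofPred_eq] at h1 h2
      have := h1 t 0
      rw [h2, Real.dist_eq t 0, sub_zero] at this
      exact this
  have hS : IsCompact S := by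
    refine ArzelaAscoli.isCompact_of_equicontinuous S hcomp ?_
    exact (LipschitzWith.uniformEquicontinuous _ K fun w => w.2.1).equicontinuous
  obtain ⟨v, -, k, hk, hlim⟩ := hS.tendsto_subseq
    (x := fun n => (⟨u n, (hu n).continuous⟩ : C(ℝ, ℝ))) fun n => ⟨hu n, hu0 n⟩
  exact ⟨v, k, v.continuous, hk, fun t => ((continuous_eval_const t).tendsto v).comp hlim⟩

/-- Data of the integrated boundary value problem `u' = ψ (a - F u - ∫ g(·, u) + s t)` with all
nonlinearities bounded. -/
structure IsBoundedShooting (ψ F : ℝ → ℝ) (g : ℝ → ℝ → ℝ) (ρ : ℝ → ℝ) (K : NNReal) (M : ℝ) :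
    Prop where
  continuous_psi : Continuous ψ
  psi_le : ∀ x, |ψ x| ≤ K
  psi_pos : ∀ x, 0 < x → 0 < ψ x
  psi_neg : ∀ x, x < 0 → ψ x < 0
  continuous_F : Continuous F
  F_le : ∀ x, |F x| ≤ M
  measurable_g : Measurable (Function.uncurry g)
  continuous_g : ∀ t, Continuous (g t)
  integrable_rho : Integrable ρ
  g_le : ∀ t x, |g t x| ≤ ρ t

/-- The value at time `t` of `φ(u')` prescribed by the profile `v`. -/
def shootArg (F : ℝ → ℝ) (g : ℝ → ℝ → ℝ) (a s : ℝ) (v : ℝ → ℝ) (t : ℝ) : ℝ :=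
  a - F (v t) - (∫ σ in (0:ℝ)..t, g σ (v σ)) + s * t

/-- The function with value `c` at `0` and derivative `ψ (shootArg F g a s v)`. -/
def shootOp (ψ F : ℝ → ℝ) (g : ℝ → ℝ → ℝ) (c a s : ℝ) (v : ℝ → ℝ) (t : ℝ) : ℝ :=
  c + ∫ τ in (0:ℝ)..t, ψ (shootArg F g a s v τ)

theorem shootOp_zero (ψ F : ℝ → ℝ) (g : ℝ → ℝ → ℝ) (c a s : ℝ) (v : ℝ → ℝ) :
    shootOp ψ F g c a s v 0 = c := by
  simp [shootOp]

namespace IsBoundedShooting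

variable {ψ F : ℝ → ℝ} {g : ℝ → ℝ → ℝ} {ρ : ℝ → ℝ} {K : NNReal} {M : ℝ}

theorem measurable_comp (hP : IsBoundedShooting ψ F g ρ K M) {v : ℝ → ℝ} (hv : Continuous v) :
    Measurable fun t => g t (v t) :=
  hP.measurable_g.comp (measurable_id.prodMk hv.measurable)

theorem integrable_comp (hP : IsBoundedShooting ψ F g ρ K M) {v : ℝ → ℝ} (hv : Continuous v) :
    Integrable fun t => g t (v t) :=
  hP.integrable_rho.mono' (hP.measurable_comp hv).aestronglyMeasurable
    (Eventually.of_forall fun t => hP.g_le t (v t))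

theorem abs_integral_comp_le (hP : IsBoundedShooting ψ F g ρ K M) (v : ℝ → ℝ) (t : ℝ) :
    |∫ σ in (0:ℝ)..t, g σ (v σ)| ≤ ∫ σ, ρ σ := by
  have h0 : ∀ σ, 0 ≤ ρ σ := fun σ => (abs_nonneg _).trans (hP.g_le σ 0)
  refine (intervalIntegral.norm_integral_le_integral_norm_uIoc (f := fun σ => g σ (v σ))).trans ?_
  have hle : ∫ σ in uIoc 0 t, ‖g σ (v σ)‖ ≤ ∫ σ in uIoc 0 t, ρ σ :=
    integral_mono_of_nonneg (Eventually.of_forall fun σ => norm_nonneg _)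
      hP.integrable_rho.integrableOn (Eventually.of_forall fun σ => hP.g_le σ _)
  exact hle.trans (setIntegral_le_integral hP.integrable_rho (Eventually.of_forall h0))

theorem continuous_shootArg (hP : IsBoundedShooting ψ F g ρ K M) (a s : ℝ) {v : ℝ → ℝ}
    (hv : Continuous v) : Continuous (shootArg F g a s v) := by
  have h1 : Continuous fun t => ∫ σ in (0:ℝ)..t, g σ (v σ) :=
    intervalIntegral.continuous_primitive
      (fun _ _ => (hP.integrable_comp hv).intervalIntegrable) 0
  have h2 : Continuous fun t => F (v t) := hP.continuous_F.comp hv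
  exact ((continuous_const.sub h2).sub h1).add (continuous_const.mul continuous_id)

theorem hasDerivAt_shootOp (hP : IsBoundedShooting ψ F g ρ K M) (c a s : ℝ) {v : ℝ → ℝ}
    (hv : Continuous v) (t : ℝ) :
    HasDerivAt (shootOp ψ F g c a s v) (ψ (shootArg F g a s v t)) t := by
  have hc : Continuous fun τ => ψ (shootArg F g a s v τ) :=
    hP.continuous_psi.comp (hP.continuous_shootArg a s hv)
  exact (hc.integral_hasStrictDerivAt 0 t).hasDerivAt.const_add c

theorem lipschitzWith_shootOp (hP : IsBoundedShooting ψ F g ρ K M) (c a s : ℝ) {v : ℝ → ℝ}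
    (hv : Continuous v) : LipschitzWith K (shootOp ψ F g c a s v) := by
  refine lipschitzWith_of_nnnorm_deriv_le
    (fun t => (hP.hasDerivAt_shootOp c a s hv t).differentiableAt) fun t => ?_
  rw [(hP.hasDerivAt_shootOp c a s hv t).deriv]
  exact hP.psi_le _

section Limits

variable {ι : Type*} {l : Filter ι} [l.IsCountablyGenerated] {a s : ι → ℝ} {v : ι → ℝ → ℝ}
  {a₀ s₀ : ℝ} {v₀ : ℝ → ℝ}

theorem tendsto_integral_comp (hP : IsBoundedShooting ψ F g ρ K M) (hv : ∀ i, Continuous (v i))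
    (hlim : ∀ t, Tendsto (fun i => v i t) l (𝓝 (v₀ t))) (t : ℝ) :
    Tendsto (fun i => ∫ σ in (0:ℝ)..t, g σ (v i σ)) l (𝓝 (∫ σ in (0:ℝ)..t, g σ (v₀ σ))) :=
  intervalIntegral.tendsto_integral_filter_of_dominated_convergence ρ
    (Eventually.of_forall fun i => (hP.measurable_comp (hv i)).aestronglyMeasurable)
    (Eventually.of_forall fun _ => Eventually.of_forall fun σ _ => hP.g_le σ _)
    hP.integrable_rho.intervalIntegrable
    (Eventually.of_forall fun σ _ => ((hP.continuous_g σ).tendsto _).comp (hlim σ))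

theorem tendsto_shootArg (hP : IsBoundedShooting ψ F g ρ K M) (hv : ∀ i, Continuous (v i))
    (ha : Tendsto a l (𝓝 a₀)) (hs : Tendsto s l (𝓝 s₀))
    (hlim : ∀ t, Tendsto (fun i => v i t) l (𝓝 (v₀ t))) (t : ℝ) :
    Tendsto (fun i => shootArg F g (a i) (s i) (v i) t) l (𝓝 (shootArg F g a₀ s₀ v₀ t)) :=
  ((ha.sub ((hP.continuous_F.tendsto _).comp (hlim t))).sub
    (hP.tendsto_integral_comp hv hlim t)).add (hs.mul_const t)

theorem tendsto_shootOp (hP : IsBoundedShooting ψ F g ρ K M) (c : ℝ) (hv : ∀ i, Continuous (v i))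
    (ha : Tendsto a l (𝓝 a₀)) (hs : Tendsto s l (𝓝 s₀))
    (hlim : ∀ t, Tendsto (fun i => v i t) l (𝓝 (v₀ t))) (t : ℝ) :
    Tendsto (fun i => shootOp ψ F g c (a i) (s i) (v i) t) l
      (𝓝 (shootOp ψ F g c a₀ s₀ v₀ t)) := by
  refine Tendsto.const_add c
    (intervalIntegral.tendsto_integral_filter_of_dominated_convergence (fun _ => (K : ℝ))
    (Eventually.of_forall fun i =>
      (hP.continuous_psi.comp (hP.continuous_shootArg _ _ (hv i))).aestronglyMeasurable)
    (Eventually.of_forall fun _ => Eventually.of_forall fun _ _ => hP.psi_le _)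
    (continuous_const.intervalIntegrable _ _)
    (Eventually.of_forall fun σ _ =>
      (hP.continuous_psi.tendsto _).comp (hP.tendsto_shootArg hv ha hs hlim σ)))

end Limits

/-- A large parameter `a` forces the sign of the increment of `shootOp` over `[0, T]`. -/
theorem mul_shootOp_sub_pos (hP : IsBoundedShooting ψ F g ρ K M) {T : ℝ} (hT : 0 < T)
    (c : ℝ) {a s : ℝ} {v : ℝ → ℝ} (hv : Continuous v)
    (ha : M + (∫ σ, ρ σ) + |s| * T < |a|) : 0 < a * (shootOp ψ F g c a s v T - c) := by
  have hcont : Continuous fun τ => ψ (shootArg F g a s v τ) :=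
    hP.continuous_psi.comp (hP.continuous_shootArg a s hv)
  have hb : ∀ τ ∈ Ioc 0 T, |shootArg F g a s v τ - a| ≤ M + (∫ σ, ρ σ) + |s| * T := by
    intro τ hτ
    have h1 := hP.F_le (v τ)
    have h2 := hP.abs_integral_comp_le v τ
    have h3 : |s * τ| ≤ |s| * T := by
      rw [abs_mul, abs_of_pos hτ.1]
      exact mul_le_mul_of_nonneg_left hτ.2 (abs_nonneg s)
    unfold shootArg
    rw [abs_le] at *
    constructor <;> linarith [h1.1, h1.2, h2.1, h2.2, h3.1, h3.2]
  have hsub : shootOp ψ F g c a s v T - c = ∫ τ in (0:ℝ)..T, ψ (shootArg F g a s v τ) := by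
    simp [shootOp]
  have hM : 0 ≤ M + (∫ σ, ρ σ) + |s| * T :=
    (abs_nonneg _).trans (hb T ⟨hT, le_rfl⟩)
  rw [hsub]
  rcases lt_trichotomy a 0 with h | h | h
  · rw [abs_of_neg h] at ha
    apply mul_pos_of_neg_of_neg h
    rw [← neg_pos, ← intervalIntegral.integral_neg]
    refine intervalIntegral.intervalIntegral_pos_of_pos_on
      (hcont.neg.intervalIntegrable _ _) (fun τ hτ => ?_) hT
    have := (abs_le.1 (hb τ ⟨hτ.1, hτ.2.le⟩)).2
    exact neg_pos.2 (hP.psi_neg _ (by linarith))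
  · rw [h, abs_zero] at ha
    exact absurd ha (not_lt.2 hM)
  · rw [abs_of_pos h] at ha
    apply mul_pos h
    refine intervalIntegral.intervalIntegral_pos_of_pos_on
      (hcont.intervalIntegrable _ _) (fun τ hτ => ?_) hT
    have := (abs_le.1 (hb τ ⟨hτ.1, hτ.2.le⟩)).1
    exact hP.psi_pos _ (by linarith)

end IsBoundedShooting

theorem shootOp_congr {ψ F : ℝ → ℝ} {g : ℝ → ℝ → ℝ} {c a s : ℝ} {v v' : ℝ → ℝ} {t : ℝ}
    (ht : 0 ≤ t) (h : ∀ τ ∈ Icc 0 t, v τ = v' τ) :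
    shootOp ψ F g c a s v t = shootOp ψ F g c a s v' t := by
  unfold shootOp shootArg
  congr 1
  refine intervalIntegral.integral_congr fun τ hτ => ?_
  rw [uIcc_of_le ht] at hτ
  rw [h τ hτ]
  congr 3
  refine intervalIntegral.integral_congr fun σ hσ => ?_
  rw [uIcc_of_le hτ.1] at hσ
  rw [h σ ⟨hσ.1, hσ.2.trans hτ.2⟩]

/-- The function `u` delayed by `ε` and frozen at its initial value before time `ε`. -/
def delay (ε : ℝ) (u : ℝ → ℝ) (t : ℝ) : ℝ := u (max (t - ε) 0)

theorem Continuous.delay {u : ℝ → ℝ} (hu : Continuous u) (ε : ℝ) : Continuous (delay ε u) :=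
  hu.comp ((continuous_id.sub continuous_const).max continuous_const)

/-- The iterates of the delayed shooting operator, starting from the constant `c`. -/
def delayIter (ψ F : ℝ → ℝ) (g : ℝ → ℝ → ℝ) (c ε a s : ℝ) : ℕ → ℝ → ℝ
  | 0 => fun _ => c
  | k + 1 => shootOp ψ F g c a s (delay ε (delayIter ψ F g c ε a s k))

namespace IsBoundedShooting

variable {ψ F : ℝ → ℝ} {g : ℝ → ℝ → ℝ} {ρ : ℝ → ℝ} {K : NNReal} {M : ℝ}

theorem lipschitzWith_delayIter (hP : IsBoundedShooting ψ F g ρ K M) (c ε a s : ℝ) (k : ℕ) :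
    LipschitzWith K (delayIter ψ F g c ε a s k) := by
  induction k with
  | zero => exact LipschitzWith.const' c
  | succ k ih => exact hP.lipschitzWith_shootOp c a s (ih.continuous.delay ε)

theorem continuous_delayIter_param (hP : IsBoundedShooting ψ F g ρ K M) (c ε : ℝ) (k : ℕ) (t : ℝ) :
    Continuous fun z : ℂ => delayIter ψ F g c ε z.re z.im k t := by
  induction k generalizing t with
  | zero => exact continuous_const
  | succ k ih =>
    refine continuous_iff_continuousAt.2 fun z => ?_
    exact hP.tendsto_shootOp c (fun z => (hP.lipschitzWith_delayIter c ε _ _ k).continuous.delay ε)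
      (Complex.continuous_re.tendsto z) (Complex.continuous_im.tendsto z)
      (fun t => (ih (max (t - ε) 0)).tendsto z) t

end IsBoundedShooting

theorem delayIter_succ_eq {ψ F : ℝ → ℝ} {g : ℝ → ℝ → ℝ} {c ε a s : ℝ} (hε : 0 ≤ ε) (k : ℕ) :
    ∀ t, 0 ≤ t → t ≤ k * ε → delayIter ψ F g c ε a s (k + 1) t = delayIter ψ F g c ε a s k t := by
  induction k with
  | zero =>
    intro t h0 h1
    obtain rfl : t = 0 := le_antisymm (by simpa using h1) h0
    exact shootOp_zero ..
  | succ k ih =>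
    intro t h0 h1
    refine shootOp_congr h0 fun τ hτ => ih _ (le_max_right _ _) (max_le ?_ (by positivity))
    push_cast at h1
    linarith [hτ.2]

namespace IsBoundedShooting

variable {ψ F : ℝ → ℝ} {g : ℝ → ℝ → ℝ} {ρ : ℝ → ℝ} {K : NNReal} {M : ℝ}

/-- Solvability of the periodic problem with delay. -/
theorem exists_delay_solution (hP : IsBoundedShooting ψ F g ρ K M) {T : ℝ} (hT : 0 < T) (c : ℝ)
    {ε : ℝ} (hε : 0 < ε) :
    ∃ (a s : ℝ) (u : ℝ → ℝ), LipschitzWith K u ∧ u 0 = c ∧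
      (∀ t ∈ Icc 0 T, u t = shootOp ψ F g c a s (delay ε u) t) ∧ u T = c ∧
      ∫ σ in (0:ℝ)..T, g σ (delay ε u σ) = s * T := by
  obtain ⟨N, hN⟩ := exists_nat_ge (T / ε)
  rw [div_le_iff₀ hε] at hN
  set L := ∫ σ, ρ σ with hL
  set w : ℂ → ℝ → ℝ := fun z => delayIter ψ F g c ε z.re z.im N with hw
  have hwc : ∀ z, Continuous (delay ε (w z)) := fun z =>
    (hP.lipschitzWith_delayIter c ε _ _ N).continuous.delay ε
  have hfix : ∀ z, ∀ t ∈ Icc 0 T, w z t = shootOp ψ F g c z.re z.im (delay ε (w z)) t :=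
    fun z t ht => (delayIter_succ_eq hε.le N t ht.1 (ht.2.trans hN)).symm
  have hL0 : 0 ≤ L := integral_nonneg fun σ => (abs_nonneg _).trans (hP.g_le σ 0)
  have hM0 : 0 ≤ M := (abs_nonneg _).trans (hP.F_le 0)
  have hI : Continuous fun z : ℂ => ∫ σ in (0:ℝ)..T, g σ (delay ε (w z) σ) :=
    continuous_iff_continuousAt.2 fun z => hP.tendsto_integral_comp hwc
      (fun t => (hP.continuous_delayIter_param c ε N _).tendsto z) T
  set G : ℂ → ℂ := fun z => ((w z T - c : ℝ) : ℂ) +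
    ((z.im * T - ∫ σ in (0:ℝ)..T, g σ (delay ε (w z) σ) : ℝ) : ℂ) * Complex.I with hG
  have hGre : ∀ z, (G z).re = w z T - c := fun z => by simp [hG]
  have hGim : ∀ z, (G z).im = z.im * T - ∫ σ in (0:ℝ)..T, g σ (delay ε (w z) σ) :=
    fun z => by simp [hG]
  have hGc : Continuous G := by
    have h1 : Continuous fun z : ℂ => w z T := hP.continuous_delayIter_param c ε N T
    have h2 : Continuous fun z : ℂ => z.im * T := Complex.continuous_im.mul continuous_const
    exact (Complex.continuous_ofReal.comp (h1.sub continuous_const)).add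
      ((Complex.continuous_ofReal.comp (h2.sub hI)).mul continuous_const)
  have hTmem : T ∈ Icc 0 T := ⟨hT.le, le_rfl⟩
  obtain ⟨z, hz⟩ := Complex.exists_zero_of_ne_neg_smul hGc
    (R := M + 2 * L + L / T + 1) (by positivity) (by
      intro z hzR l hl hGz
      have hre := congrArg Complex.re hGz
      have him := congrArg Complex.im hGz
      rw [hGre] at hre
      rw [hGim] at him
      simp only [Complex.neg_re, Complex.re_ofReal_mul, Complex.neg_im, Complex.im_ofReal_mul]
        at hre him
      have hsT : |z.im| * T ≤ L := by
        have h1 : z.im * (T + l) = ∫ σ in (0:ℝ)..T, g σ (delay ε (w z) σ) := by linarith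
        have h2 := hP.abs_integral_comp_le (delay ε (w z)) T
        rw [← h1, abs_mul, abs_of_pos (by linarith : 0 < T + l)] at h2
        nlinarith [abs_nonneg z.im]
      have hs : |z.im| ≤ L / T := (le_div_iff₀ hT).2 hsT
      have ha : M + L + |z.im| * T < |z.re| := by
        have := Complex.norm_le_abs_re_add_abs_im z
        linarith
      have hpos := hP.mul_shootOp_sub_pos hT c (hwc z) ha
      rw [← hfix z T hTmem, hre] at hpos
      nlinarith [mul_nonneg hl (mul_self_nonneg z.re)])
  have h1 := hGre z
  have h2 := hGim z
  rw [hz] at h1 h2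
  simp only [Complex.zero_re, Complex.zero_im] at h1 h2
  refine ⟨z.re, z.im, w z, hP.lipschitzWith_delayIter c ε _ _ N, ?_, hfix z, by linarith,
    by linarith⟩
  rw [hfix z 0 ⟨le_rfl, hT.le⟩, shootOp_zero]

/-- Solvability of the integrated periodic problem with bounded nonlinearities. -/
theorem exists_solution (hP : IsBoundedShooting ψ F g ρ K M) {T : ℝ} (hT : 0 < T) (c : ℝ) :
    ∃ (a s : ℝ) (u : ℝ → ℝ), Continuous u ∧ |a| ≤ M + 2 * (∫ σ, ρ σ) ∧ |s| * T ≤ ∫ σ, ρ σ ∧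
      (∀ t ∈ Icc 0 T, u t = shootOp ψ F g c a s u t) ∧ u T = c ∧
      ∫ σ in (0:ℝ)..T, g σ (u σ) = s * T := by
  set L := ∫ σ, ρ σ with hL
  choose a s u hu hu0 hfix huT hgT using fun n : ℕ =>
    hP.exists_delay_solution hT c (Nat.one_div_pos_of_nat (α := ℝ) (n := n))
  have hdc : ∀ n : ℕ, Continuous (delay (1 / ((n : ℝ) + 1)) (u n)) := fun n =>
    (hu n).continuous.delay _
  have hs : ∀ n, |s n| * T ≤ L := fun n => by
    have := hP.abs_integral_comp_le (delay (1 / ((n : ℝ) + 1)) (u n)) T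
    rwa [hgT n, abs_mul, abs_of_pos hT] at this
  have ha : ∀ n, |a n| ≤ M + 2 * L := fun n => by
    by_contra! hlt
    have := hP.mul_shootOp_sub_pos hT c (a := a n) (s := s n) (hdc n) (by linarith [hs n])
    rw [← hfix n T ⟨hT.le, le_rfl⟩, huT n] at this
    simp at this
  obtain ⟨v, k, hv, hk, hlim⟩ := exists_subseq_tendsto_of_lipschitzWith hu hu0
  obtain ⟨⟨a₀, s₀⟩, hmem, j, hj, hjlim⟩ :=
    ((isCompact_Icc (a := -(M + 2 * L)) (b := M + 2 * L)).prod
      (isCompact_Icc (a := -(L / T)) (b := L / T))).tendsto_subseq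
      (x := fun n => (a (k n), s (k n))) fun n =>
        ⟨abs_le.1 (ha _), abs_le.1 ((le_div_iff₀ hT).2 (hs _))⟩
  set m : ℕ → ℕ := fun n => k (j n) with hm
  have hmt : Tendsto m atTop atTop := hk.tendsto_atTop.comp hj.tendsto_atTop
  have ha₀ : Tendsto (fun n => a (m n)) atTop (𝓝 a₀) := (continuous_fst.tendsto _).comp hjlim
  have hs₀ : Tendsto (fun n => s (m n)) atTop (𝓝 s₀) := (continuous_snd.tendsto _).comp hjlim
  have hum : ∀ t, Tendsto (fun n => u (m n) t) atTop (𝓝 (v t)) := fun t =>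
    (hlim t).comp hj.tendsto_atTop
  have hdelay : ∀ t, Tendsto (fun n => delay (1 / ((m n : ℝ) + 1)) (u (m n)) t) atTop
      (𝓝 (v (max t 0))) := by
    intro t
    refine (hum (max t 0)).congr_dist ?_
    have hε : Tendsto (fun n => (K : ℝ) * (1 / ((m n : ℝ) + 1))) atTop (𝓝 0) := by
      simpa using (tendsto_one_div_add_atTop_nhds_zero_nat.comp hmt).const_mul (K : ℝ)
    refine squeeze_zero (fun _ => dist_nonneg) (fun n => ?_) hε
    refine ((hu (m n)).dist_le_mul _ _).trans (mul_le_mul_of_nonneg_left ?_ K.2)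
    have h1 : 0 < 1 / ((m n : ℝ) + 1) := Nat.one_div_pos_of_nat
    rw [Real.dist_eq]
    refine (abs_max_sub_max_le_abs _ _ _).trans_eq ?_
    rw [sub_sub_cancel, abs_of_pos h1]
  refine ⟨a₀, s₀, fun t => v (max t 0), hv.comp (continuous_id.max continuous_const),
    abs_le.2 hmem.1, (le_div_iff₀ hT).1 (abs_le.2 hmem.2), fun t ht => ?_, ?_, ?_⟩
  · simp only [max_eq_left ht.1]
    refine tendsto_nhds_unique (hum t) ?_
    refine (hP.tendsto_shootOp c (fun n => hdc (m n)) ha₀ hs₀ hdelay t).congr fun n => ?_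
    exact (hfix (m n) t ht).symm
  · simp only [max_eq_left hT.le]
    refine tendsto_nhds_unique (hum T) ?_
    simp only [huT]
    exact tendsto_const_nhds
  · refine tendsto_nhds_unique (hP.tendsto_integral_comp (fun n => hdc (m n)) hdelay T) ?_
    simp only [hgT]
    exact hs₀.mul_const T

end IsBoundedShooting

theorem exists_coercive_bound {φ : ℝ → ℝ} (hmono : Monotone φ) (hsurj : Function.Surjective φ)
    (h0 : φ 0 = 0) {k : ℝ} (hk : 0 ≤ k) : ∃ C : ℝ, 0 ≤ C ∧ ∀ x, k * |x| - C ≤ φ x * x := by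
  obtain ⟨p, hp⟩ := hsurj k
  obtain ⟨q, hq⟩ := hsurj (-k)
  refine ⟨k * (|p| + |q|), by positivity, fun x => ?_⟩
  rcases le_total 0 x with hx | hx
  · rw [abs_of_nonneg hx]
    rcases le_total p x with hpx | hpx
    · have := hmono hpx
      nlinarith [mul_nonneg hk (add_nonneg (abs_nonneg p) (abs_nonneg q)),
        mul_le_mul_of_nonneg_right this hx]
    · have h1 : 0 ≤ φ x * x := mul_nonneg (h0 ▸ hmono hx) hx
      have h2 : x ≤ |p| + |q| := by linarith [le_abs_self p, abs_nonneg q]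
      nlinarith [mul_le_mul_of_nonneg_left h2 hk]
  · rw [abs_of_nonpos hx]
    have hx' : 0 ≤ -x := by linarith
    rcases le_total x q with hxq | hxq
    · have := hmono hxq
      nlinarith [mul_nonneg hk (add_nonneg (abs_nonneg p) (abs_nonneg q)),
        mul_le_mul_of_nonneg_right this hx']
    · have h1 : 0 ≤ φ x * x := mul_nonneg_of_nonpos_of_nonpos (h0 ▸ hmono hx) hx
      have h2 : -x ≤ |p| + |q| := by linarith [neg_le_abs q, abs_nonneg p]
      nlinarith [mul_le_mul_of_nonneg_left h2 hk]

/-- A priori bound for the total variation of a periodic `U`: the part of the flux `y` which is a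
function of `U` alone does no work over a period. -/
theorem integral_abs_deriv_le {T : ℝ} (hT : 0 < T) {U du y B : ℝ → ℝ} {L C : ℝ}
    (hU : ∀ t, HasDerivAt U (du t) t) (hdu : Continuous du) (hB : Continuous B) (hper : U 0 = U T)
    (hyB : ∀ t ∈ Icc 0 T, |y t - B (U t)| ≤ 2 * L)
    (hcoer : ∀ t ∈ Icc 0 T, (2 * L + 1) * |du t| - C ≤ y t * du t) :
    ∫ t in (0:ℝ)..T, |du t| ≤ C * T := by
  have hUc : Continuous U := continuous_iff_continuousAt.2 fun t => (hU t).continuousAt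
  have hwork : ∫ t in (0:ℝ)..T, B (U t) * du t = 0 := by
    have := intervalIntegral.integral_comp_mul_deriv (a := 0) (b := T) (fun t _ => hU t)
      hdu.continuousOn hB
    simpa [hper] using this
  have hi : ∀ {h : ℝ → ℝ}, Continuous h → IntervalIntegrable h volume 0 T :=
    fun h => h.intervalIntegrable _ _
  have hBU : Continuous fun t => B (U t) * du t := (hB.comp hUc).mul hdu
  have hle : ∫ t in (0:ℝ)..T, (|du t| - C) ≤ ∫ t in (0:ℝ)..T, B (U t) * du t := by
    refine intervalIntegral.integral_mono_on hT.le (hi (by fun_prop)) (hi hBU) fun t ht => ?_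
    have h1 := hcoer t ht
    have h2 : (y t - B (U t)) * du t ≤ 2 * L * |du t| := by
      refine (le_abs_self _).trans ?_
      rw [abs_mul]
      exact mul_le_mul_of_nonneg_right (hyB t ht) (abs_nonneg _)
    linarith
  rw [hwork, intervalIntegral.integral_sub (hi hdu.abs) (hi continuous_const)] at hle
  simp only [intervalIntegral.integral_const, sub_zero, smul_eq_mul] at hle
  linarith

theorem abs_sub_le_integral_abs_deriv {T : ℝ} {U du : ℝ → ℝ}
    (hU : ∀ t, HasDerivAt U (du t) t) (hdu : Continuous du) {t : ℝ} (ht : t ∈ Icc 0 T) :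
    |U t - U 0| ≤ ∫ τ in (0:ℝ)..T, |du τ| := by
  rw [← intervalIntegral.integral_eq_sub_of_hasDerivAt (fun τ _ => hU τ)
    (hdu.intervalIntegrable 0 t)]
  refine (intervalIntegral.abs_integral_le_integral_abs ht.1).trans ?_
  exact intervalIntegral.integral_mono_interval le_rfl ht.1 ht.2
    (Eventually.of_forall fun τ => abs_nonneg _) (hdu.abs.intervalIntegrable _ _)

/-- The truncation of a Carathéodory function which is dominated on `[0, ∞)` can be regularised on
a null set so as to be jointly measurable, continuous in `u` and globally dominated. -/
theorem exists_regular_truncation {T : ℝ} {g : ℝ → ℝ → ℝ} (hCar : Caratheodory T g) {ρ : ℝ → ℝ}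
    (hρ : IntegrableOn ρ (Icc (0:ℝ) T))
    (hb : ∀ᵐ t ∂(muT T), ∀ u : ℝ, 0 ≤ u → |g t u| ≤ ρ t) :
    ∃ (g' : ℝ → ℝ → ℝ) (ρ' : ℝ → ℝ), Measurable (Function.uncurry g') ∧
      (∀ t, Continuous (g' t)) ∧ Integrable ρ' ∧ (∀ t u, |g' t u| ≤ ρ' t) ∧
      ∀ᵐ t ∂(muT T), ∀ u, 0 ≤ u → g' t u = g t u := by
  obtain ⟨hmeas, hcont, -⟩ := hCar
  have hgood := hcont.and hb
  rw [muT] at hgood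
  obtain ⟨N, hN, hNm, hN0⟩ := exists_measurable_superset_of_null (ae_iff.1 hgood)
  set S := Icc 0 T \ N with hS
  have hSm : MeasurableSet S := measurableSet_Icc.diff hNm
  have hSgood : ∀ t ∈ S, (Continuous fun u => g t u) ∧ ∀ u : ℝ, 0 ≤ u → |g t u| ≤ ρ t := by
    intro t ht
    by_contra h
    exact ht.2 (hN h)
  have hcont' : ∀ t, Continuous fun u => S.indicator (fun t => g t (max u 0)) t := by
    intro t
    by_cases ht : t ∈ S
    · simp only [indicator_of_mem ht]
      exact (hSgood t ht).1.comp (continuous_id.max continuous_const)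
    · simp only [indicator_of_notMem ht]
      exact continuous_const
  refine ⟨fun t u => S.indicator (fun t => g t (max u 0)) t, S.indicator ρ, ?_, hcont', ?_, ?_, ?_⟩
  · exact (measurable_uncurry_of_continuous_of_measurable
      (u := fun u t => S.indicator (fun t => g t (max u 0)) t) hcont'
      fun u => (hmeas _).indicator hSm).comp measurable_swap
  · exact (integrable_indicator_iff hSm).2 (hρ.mono_set sdiff_subset)
  · intro t u
    by_cases ht : t ∈ S
    · simp only [indicator_of_mem ht]
      exact (hSgood t ht).2 _ (le_max_right _ _)
    · simp [indicator_of_notMem ht]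
  · have h1 : ∀ᵐ t ∂(muT T), t ∉ N := measure_eq_zero_iff_ae_notMem.1 hN0
    have h2 : ∀ᵐ t ∂(muT T), t ∈ Icc 0 T := ae_restrict_mem measurableSet_Icc
    filter_upwards [h1, h2] with t ht1 ht2 u hu
    have ht : t ∈ S := ⟨ht2, ht1⟩
    simp only [indicator_of_mem ht, max_eq_left hu]

/-- Existence of `T`-periodic solutions above any level `d > 0` when `g` is dominated on `[0, ∞)`. -/
theorem exists_periodic_solution_ge {T : ℝ} (hT : 0 < T) {φ f : ℝ → ℝ} (hφmono : StrictMono φ)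
    (hφsurj : Function.Surjective φ) (hφ0 : φ 0 = 0) (hf : Continuous f) {g : ℝ → ℝ → ℝ}
    (hCar : Caratheodory T g) {ρ : ℝ → ℝ} (hρ : IntegrableOn ρ (Icc (0:ℝ) T))
    (hb : ∀ᵐ t ∂(muT T), ∀ u : ℝ, 0 ≤ u → |g t u| ≤ ρ t) {d : ℝ} (hd : 0 < d) :
    ∃ g₀ : ℝ, ∃ u₀ : ℝ → ℝ, IsSolEs T φ f g g₀ u₀ ∧ ∀ t ∈ Icc (0:ℝ) T, d ≤ u₀ t := by
  obtain ⟨g', ρ', hg'm, hg'c, hρ', hg'b, hgg'⟩ := exists_regular_truncation hCar hρ hb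
  set L := ∫ σ, ρ' σ with hL
  have hL0 : 0 ≤ L := integral_nonneg fun σ => (abs_nonneg _).trans (hg'b σ 0)
  obtain ⟨C, hC, hcoer⟩ :=
    exists_coercive_bound hφmono.monotone hφsurj hφ0 (k := 2 * L + 1) (by positivity)
  set c := d + C * T with hc
  set lo := c - C * T with hlo
  set hi := c + C * T with hhi
  set F₁ : ℝ → ℝ := fun x => ∫ y in (0:ℝ)..x, f y with hF₁
  have hF₁d : ∀ x, HasDerivAt F₁ (f x) x := fun x => (hf.integral_hasStrictDerivAt 0 x).hasDerivAt
  have hF₁c : Continuous F₁ := continuous_iff_continuousAt.2 fun x => (hF₁d x).continuousAt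
  set F : ℝ → ℝ := fun x => F₁ (max lo (min x hi)) with hF
  have hlohi : lo ≤ hi := by
    have : 0 ≤ C * T := by positivity
    linarith
  have hFc : Continuous F := hF₁c.comp (by fun_prop)
  obtain ⟨M, hM⟩ : ∃ M, ∀ x, |F x| ≤ M := by
    obtain ⟨M, hM⟩ := isCompact_Icc.exists_bound_of_continuousOn (hF₁c.continuousOn (s := Icc lo hi))
    exact ⟨M, fun x => hM _ ⟨le_max_left _ _, max_le hlohi (min_le_right _ _)⟩⟩
  have hM0 : 0 ≤ M := (abs_nonneg _).trans (hM 0)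
  set Q := 2 * M + 4 * L + 1 with hQ
  have hQ0 : 0 < Q := by positivity
  set e := hφmono.orderIsoOfSurjective φ hφsurj with he
  have heφ : ∀ x, φ (e.symm x) = x := fun x => e.apply_symm_apply x
  have he0 : e.symm 0 = 0 := e.symm_apply_eq.2 hφ0.symm
  set ψ : ℝ → ℝ := fun x => e.symm (max (-Q) (min x Q)) with hψ
  have hψφ : ∀ x, |x| ≤ Q → φ (ψ x) = x := by
    intro x hx
    rw [abs_le] at hx
    rw [hψ]
    simp only
    rw [heφ, min_eq_left hx.2, max_eq_right hx.1]
  have hP : IsBoundedShooting ψ F g' ρ' (max |e.symm (-Q)| |e.symm Q|).toNNReal M :=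
    { continuous_psi := e.symm.continuous.comp (by fun_prop)
      psi_le := fun x => by
        rw [Real.coe_toNNReal _ (le_max_of_le_left (abs_nonneg _))]
        exact abs_le_max_abs_abs (e.symm.monotone (le_max_left _ _))
          (e.symm.monotone (max_le (by linarith) (min_le_right _ _)))
      psi_pos := fun x hx => by
        rw [← he0]
        exact e.symm.strictMono (lt_max_of_lt_right (lt_min hx hQ0))
      psi_neg := fun x hx => by
        rw [← he0]
        exact e.symm.strictMono (max_lt (by linarith) (min_lt_of_left_lt hx))
      continuous_F := hFc
      F_le := hM
      measurable_g := hg'm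
      continuous_g := hg'c
      integrable_rho := hρ'
      g_le := hg'b }
  obtain ⟨a, s, u, huc, ha, hs, hfix, huT, hgT⟩ := hP.exists_solution hT c
  set y := shootArg F g' a s u with hy
  set U := shootOp ψ F g' c a s u with hU
  have hyc : Continuous y := hP.continuous_shootArg a s huc
  have hUd : ∀ t, HasDerivAt U (ψ (y t)) t := hP.hasDerivAt_shootOp c a s huc
  have hUc : Continuous U := continuous_iff_continuousAt.2 fun t => (hUd t).continuousAt
  have hduc : Continuous fun t => ψ (y t) := hP.continuous_psi.comp hyc
  have hU0 : U 0 = c := shootOp_zero ..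
  have hUT : U T = c := by rw [← hfix T ⟨hT.le, le_rfl⟩, huT]
  have hyU : ∀ t ∈ Icc 0 T, y t = a - F (U t) - (∫ σ in (0:ℝ)..t, g' σ (U σ)) + s * t := by
    intro t ht
    have hint : ∫ σ in (0:ℝ)..t, g' σ (u σ) = ∫ σ in (0:ℝ)..t, g' σ (U σ) := by
      refine intervalIntegral.integral_congr fun σ hσ => ?_
      rw [uIcc_of_le ht.1] at hσ
      rw [hfix σ ⟨hσ.1, hσ.2.trans ht.2⟩]
    rw [hy, shootArg, hint, hfix t ht]
  have hst : ∀ t ∈ Icc 0 T, |s * t| ≤ L := by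
    intro t ht
    rw [abs_mul, abs_of_nonneg ht.1]
    exact (mul_le_mul_of_nonneg_left ht.2 (abs_nonneg s)).trans hs
  have hyB : ∀ t ∈ Icc 0 T, |y t - (a - F (U t))| ≤ 2 * L := by
    intro t ht
    have h1 := abs_le.1 (hP.abs_integral_comp_le U t)
    have h2 := abs_le.1 (hst t ht)
    rw [hyU t ht, abs_le]
    constructor <;> linarith [h1.1, h1.2, h2.1, h2.2]
  have hφy : ∀ t ∈ Icc 0 T, φ (ψ (y t)) = y t := by
    intro t ht
    apply hψφ
    have h1 := abs_le.1 (hyB t ht)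
    have h2 := abs_le.1 (hM (U t))
    have h3 := abs_le.1 ha
    rw [abs_le]
    constructor <;> linarith [h1.1, h1.2, h2.1, h2.2, h3.1, h3.2]
  have hvar : ∫ t in (0:ℝ)..T, |ψ (y t)| ≤ C * T :=
    integral_abs_deriv_le hT hUd hduc (continuous_const.sub hFc) (hU0.trans hUT.symm) hyB
      fun t ht => by
        have := hcoer (ψ (y t))
        rwa [hφy t ht] at this
  have hUmem : ∀ t ∈ Icc 0 T, lo ≤ U t ∧ U t ≤ hi := by
    intro t ht
    have := abs_le.1 ((abs_sub_le_integral_abs_deriv hUd hduc ht).trans hvar)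
    rw [hU0] at this
    constructor <;> linarith [this.1, this.2]
  have hlod : lo = d := by rw [hlo, hc]; ring
  have hFU : ∀ t ∈ Icc 0 T, F (U t) = F₁ (U t) := by
    intro t ht
    rw [hF]
    simp only
    rw [min_eq_left (hUmem t ht).2, max_eq_right (hUmem t ht).1]
  have hw1 : Continuous fun t => f (U t) * ψ (y t) := (hf.comp hUc).mul hduc
  have hw2 : Integrable fun t => g' t (U t) := hP.integrable_comp hUc
  have h0mem : (0:ℝ) ∈ Icc 0 T := ⟨le_rfl, hT.le⟩
  refine ⟨s, U, ⟨fun t => ψ (y t), fun t => s - f (U t) * ψ (y t) - g' t (U t),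
    ⟨fun t _ => (hUd t).hasDerivWithinAt, hduc.continuousOn, hU0.trans hUT.symm, ?_⟩,
    ⟨?_, fun t ht => ?_⟩, ?_⟩, fun t ht => hlod ▸ (hUmem t ht).1⟩
  · have : y 0 = y T := by
      have hgT' : ∫ σ in (0:ℝ)..T, g' σ (u σ) = s * T := hgT
      have huz : u 0 = c := (hfix 0 h0mem).trans hU0
      simp only [hy, shootArg, hgT', huz, huT]
      simp
    simp only [this]
  · exact ((continuous_const.sub hw1).continuousOn.integrableOn_Icc).sub hw2.integrableOn
  · have hwork : ∫ τ in (0:ℝ)..t, f (U τ) * ψ (y τ) = F₁ (U t) - F₁ (U 0) := by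
      refine intervalIntegral.integral_eq_sub_of_hasDerivAt (f := fun τ => F₁ (U τ))
        (fun τ _ => (hF₁d (U τ)).comp τ (hUd τ)) (hw1.intervalIntegrable _ _)
    have hsub : ∫ τ in (0:ℝ)..t, (s - f (U τ) * ψ (y τ) - g' τ (U τ)) =
        s * t - (F₁ (U t) - F₁ (U 0)) - ∫ τ in (0:ℝ)..t, g' τ (U τ) := by
      rw [intervalIntegral.integral_sub (f := fun τ => s - f (U τ) * ψ (y τ))
        ((continuous_const.sub hw1).intervalIntegrable _ _) hw2.intervalIntegrable,
        intervalIntegral.integral_sub (continuous_const.intervalIntegrable _ _)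
        (hw1.intervalIntegrable _ _), hwork, intervalIntegral.integral_const, sub_zero, smul_eq_mul,
        mul_comm]
    rw [hsub, hφy t ht, hφy 0 h0mem, hyU t ht, hyU 0 h0mem, hFU t ht, hFU 0 h0mem,
      intervalIntegral.integral_same]
    ring
  · have h2 : ∀ᵐ t ∂(muT T), t ∈ Icc 0 T := ae_restrict_mem measurableSet_Icc
    filter_upwards [hgg', h2] with t ht ht2
    rw [ht (U t) (by linarith [(hUmem t ht2).1])]
    ring

theorem Caratheodory.neg_comp_neg {T : ℝ} {g : ℝ → ℝ → ℝ} (hg : Caratheodory T g) :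
    Caratheodory T fun t u => -g t (-u) := by
  refine ⟨fun u => (hg.1 (-u)).neg, hg.2.1.mono fun t ht => (ht.comp continuous_neg).neg,
    fun r hr => ?_⟩
  obtain ⟨γ, hγ, h⟩ := hg.2.2 r hr
  refine ⟨γ, hγ, h.mono fun t ht u hu => ?_⟩
  rw [abs_neg]
  exact ht _ (by rwa [abs_neg])

theorem IsSolEs.neg {T : ℝ} {φ f : ℝ → ℝ} {g : ℝ → ℝ → ℝ} {s : ℝ} {u : ℝ → ℝ}
    (h : IsSolEs T (fun x => -φ (-x)) (fun x => f (-x)) (fun t x => -g t (-x)) s u) :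
    IsSolEs T φ f g (-s) fun t => -u t := by
  obtain ⟨u', w, ⟨hd, hc, h0, h0'⟩, ⟨hi, hw⟩, heq⟩ := h
  refine ⟨fun t => -u' t, fun t => -w t, ⟨fun t ht => (hd t ht).neg, hc.neg, by simp only [h0],
    by simp only [h0']⟩, ⟨hi.neg, fun t ht => ?_⟩, heq.mono fun t ht => ?_⟩
  · have := hw t ht
    rw [intervalIntegral.integral_neg]
    linarith
  · simp only [← ht]
    ring

/-- If `|g(t,u)| ≤ ρ(t)` for all `u ≥ 0` (resp. all `u ≤ 0`), then for every `d > 0`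
there exists `g₀ ∈ ℝ` such that `(φ(u'))' + f(u)u' + g(t,u) = g₀` has a `T`-periodic
solution `u₀ ≥ d` (resp. `u₀ ≤ −d`) on `[0,T]`. -/
theorem statement13
    (T : ℝ) (hT : 0 < T)
    (φ f : ℝ → ℝ)
    (hφmono : StrictMono φ) (hφcont : Continuous φ)
    (hφsurj : Function.Surjective φ) (hφ0 : φ 0 = 0)
    (hf : Continuous f)
    (g : ℝ → ℝ → ℝ) (hCar : Caratheodory T g)
    (ρ : ℝ → ℝ) (hρint : IntegrableOn ρ (Icc (0:ℝ) T))
    (hρpos : ∀ᵐ t ∂(muT T), 0 ≤ ρ t) :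
    ((∀ᵐ t ∂(muT T), ∀ u : ℝ, 0 ≤ u → |g t u| ≤ ρ t) →
      ∀ d : ℝ, 0 < d → ∃ g₀ : ℝ, ∃ u₀ : ℝ → ℝ, IsSolEs T φ f g g₀ u₀ ∧
        ∀ t ∈ Icc (0:ℝ) T, d ≤ u₀ t) ∧
    ((∀ᵐ t ∂(muT T), ∀ u : ℝ, u ≤ 0 → |g t u| ≤ ρ t) →
      ∀ d : ℝ, 0 < d → ∃ g₀ : ℝ, ∃ u₀ : ℝ → ℝ, IsSolEs T φ f g g₀ u₀ ∧
        ∀ t ∈ Icc (0:ℝ) T, u₀ t ≤ -d) := by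
  refine ⟨fun hb d hd => exists_periodic_solution_ge hT hφmono hφsurj hφ0 hf hCar hρint hb hd,
    fun hb d hd => ?_⟩
  obtain ⟨s, u, hu, hud⟩ := exists_periodic_solution_ge hT (φ := fun x => -φ (-x))
    (fun x y hxy => neg_lt_neg (hφmono (neg_lt_neg hxy)))
    (fun y => (hφsurj (-y)).elim fun x hx => ⟨-x, by simp [hx]⟩) (by simp [hφ0])
    (hf.comp continuous_neg) hCar.neg_comp_neg hρint
    (hb.mono fun t ht u hu => by
      rw [abs_neg]
      exact ht _ (neg_nonpos.2 hu)) hd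
  exact ⟨-s, fun t => -u t, hu.neg, fun t ht => neg_le_neg (hud t ht)⟩
end
end
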